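/- As n → ∞, p_{1/3}(n) ~ ((25π)^{1/4} · e^{225ζ(3)³/π⁸ − 2ζ(3)/π² + 3ζ'(−1)} / (4·(5n)^{13/16})) · exp( (4π/15)·(5n)^{3/4} + (3ζ(3)/π²)·(5n)^{1/2} + ((π⁶ − 135ζ(3)²)/(6π⁵))·(5n)^{1/4} ). -/

import Mathlib

open Filter Topology Real

/-- The Piatetski-Shapiro part: `⌊ℓ^κ⌋`. -/
noncomputable def psPart (κ : ℝ) (ℓ : ℕ) : ℕ := ⌊(ℓ : ℝ) ^ κ⌋₊

/-- `p_κ(n)`: number of partitions of `n` into parts from `(⌊ℓ^κ⌋)_{ℓ ≥ 1}`. -/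
noncomputable def pk (κ : ℝ) (n : ℕ) : ℕ :=
  Nat.card {r : ℕ →₀ ℕ // (r.sum fun ℓ j => j * psPart κ (ℓ + 1)) = n}

/-- Riemann zeta at a real argument (real-valued there). -/
noncomputable def realZeta (x : ℝ) : ℝ := (riemannZeta (x : ℂ)).re

/-- Derivative of the Riemann zeta function at a real argument (real-valued there). -/
noncomputable def realZetaDeriv (x : ℝ) : ℝ := (deriv riemannZeta (x : ℂ)).re

/-- The Bose function `1 / (e^u - 1) = ∑_{m ≥ 1} e^{-mu}`. -/
noncomputable def bose (u : ℝ) : ℝ := 1 / (Real.exp u - 1)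

/-- The heat trace `∑_{ℓ ≥ 1} e^{-⌊ℓ^{1/3}⌋ u} = ∑_{m ≥ 1} (3m² + 3m + 1) e^{-mu}`
in closed form. -/
noncomputable def heatTrace (u : ℝ) : ℝ := 6 * bose u * (1 + bose u) ^ 2 + bose u

lemma bose_pos {u : ℝ} (hu : 0 < u) : 0 < bose u := by
  have := Real.add_one_lt_exp hu.ne'
  unfold bose
  exact one_div_pos.2 (by linarith)

lemma heatTrace_pos {u : ℝ} (hu : 0 < u) : 0 < heatTrace u := by
  have := bose_pos hu
  unfold heatTrace
  positivity

lemma abs_bose_sub_le {u : ℝ} (hu : 0 < u) (hu1 : u ≤ 1) :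
    |bose u - (1 / u - 1 / 2 + u / 12)| ≤ u ^ 3 := by
  have h := Real.exp_bound (x := u) (by rwa [abs_of_pos hu]) (n := 5) (by norm_num)
  rw [abs_of_pos hu] at h
  simp only [Finset.sum_range_succ, Finset.sum_range_zero, Nat.factorial] at h
  norm_num at h
  set r := Real.exp u - (1 + u + u ^ 2 / 2 + u ^ 3 / 6 + u ^ 4 / 24) with hr
  have hexp : Real.exp u - 1 = u + u ^ 2 / 2 + u ^ 3 / 6 + u ^ 4 / 24 + r := by rw [hr]; ring
  have h1 : u ≤ Real.exp u - 1 := by linarith [Real.add_one_le_exp u]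
  have hpos : 0 < Real.exp u - 1 := by linarith
  have key : bose u - (1 / u - 1 / 2 + u / 12) =
      -((u ^ 5 / 288 - u ^ 4 / 144) + r * (1 / u - 1 / 2 + u / 12)) / (Real.exp u - 1) := by
    unfold bose
    rw [eq_div_iff hpos.ne', sub_mul, one_div_mul_cancel hpos.ne', hexp]
    field_simp
    ring
  rw [key, abs_div, abs_of_pos hpos, div_le_iff₀ hpos, abs_neg]
  have hb : |1 / u - 1 / 2 + u / 12| ≤ 1 / u := by
    have : 1 ≤ 1 / u := by rw [le_div_iff₀ hu]; linarith
    rw [abs_le]; constructor <;> linarith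
  have hr' : |r * (1 / u - 1 / 2 + u / 12)| ≤ u ^ 4 * (1 / 100) := by
    rw [abs_mul]
    calc |r| * |1 / u - 1 / 2 + u / 12| ≤ (u ^ 5 * (1 / 100)) * (1 / u) := by
          gcongr
      _ = u ^ 4 * (1 / 100) := by field_simp
  have h5 : u ^ 5 ≤ u ^ 4 := pow_le_pow_of_le_one hu.le hu1 (by norm_num)
  have h4 : 0 < u ^ 4 := by positivity
  have h50 : 0 < u ^ 5 := by positivity
  have : u ^ 4 ≤ u ^ 3 * (Real.exp u - 1) := by
    calc u ^ 4 = u ^ 3 * u := by ring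
      _ ≤ _ := by gcongr
  rw [abs_le] at hr' ⊢
  constructor <;> linarith [hr'.1, hr'.2]

lemma abs_heatTrace_sub_le {u : ℝ} (hu : 0 < u) (hu1 : u ≤ 1) :
    |heatTrace u - (6 / u ^ 3 + 3 / u ^ 2 + 1 / u - 3 / 4)| ≤ 200 * u := by
  have he := abs_bose_sub_le hu hu1
  set e := bose u - (1 / u - 1 / 2 + u / 12) with hedef
  set β := 1 / u - 1 / 2 + u / 12 with hβ
  have hb : bose u = β + e := by rw [hedef]; ring
  have hβ0 : 0 ≤ β ∧ β ≤ 1 / u := by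
    have : 1 ≤ 1 / u := by rw [le_div_iff₀ hu]; linarith
    constructor <;> linarith
  have hpoly : 6 * β ^ 3 + 12 * β ^ 2 + 7 * β - (6 / u ^ 3 + 3 / u ^ 2 + 1 / u - 3 / 4) =
      u * (u ^ 2 / 288 + u / 48 + 1 / 12) := by
    rw [hβ]
    field_simp
    ring
  have key : heatTrace u - (6 / u ^ 3 + 3 / u ^ 2 + 1 / u - 3 / 4) =
      u * (u ^ 2 / 288 + u / 48 + 1 / 12) + (18 * β ^ 2 * e + 18 * β * e ^ 2 + 6 * e ^ 3
        + 24 * β * e + 12 * e ^ 2 + 7 * e) := by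
    rw [← hpoly, heatTrace, hb]
    ring
  have hβ' : |β| ≤ 1 / u := by rw [abs_of_nonneg hβ0.1]; exact hβ0.2
  have h1 : |β * e| ≤ u ^ 2 := by
    rw [abs_mul]
    calc |β| * |e| ≤ 1 / u * u ^ 3 := by gcongr
      _ = u ^ 2 := by field_simp
  have h2 : |β ^ 2 * e| ≤ u := by
    rw [sq, mul_assoc, abs_mul]
    calc |β| * |β * e| ≤ 1 / u * u ^ 2 := by gcongr
      _ = u := by field_simp
  have hu2 : u ^ 2 ≤ u := by nlinarith
  have hu3 : u ^ 3 ≤ u := by nlinarith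
  have he1 : |e| ≤ 1 := by linarith
  have h3 : |β * e ^ 2| ≤ u := by
    rw [sq, ← mul_assoc, abs_mul]
    calc |β * e| * |e| ≤ u ^ 2 * 1 := by gcongr
      _ ≤ u := by linarith
  have h4 : |e ^ 2| ≤ u := by
    rw [sq, abs_mul]
    calc |e| * |e| ≤ u ^ 3 * 1 := by gcongr
      _ ≤ u := by linarith
  have h5 : |e ^ 3| ≤ u := by
    rw [pow_succ, abs_mul]
    calc |e ^ 2| * |e| ≤ u * 1 := by gcongr
      _ ≤ u := by linarith
  have h0 : |u * (u ^ 2 / 288 + u / 48 + 1 / 12)| ≤ u := by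
    rw [abs_of_nonneg (by positivity)]
    nlinarith
  rw [key]
  rw [abs_le] at *
  constructor <;> linarith [h0.1, h0.2, h1.1, h1.2, h2.1, h2.2, h3.1, h3.2, h4.1, h4.2, h5.1, h5.2,
    he.1, he.2]

lemma bose_le_two_mul_exp_neg {u : ℝ} (hu : 1 ≤ u) : bose u ≤ 2 * Real.exp (-u) := by
  have h := Real.add_one_le_exp u
  unfold bose
  rw [Real.exp_neg, div_le_iff₀ (by linarith)]
  field_simp
  linarith

lemma heatTrace_le_exp_neg {u : ℝ} (hu : 1 ≤ u) : heatTrace u ≤ 50 * Real.exp (-u) := by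
  have h0 := bose_pos (lt_of_lt_of_le one_pos hu)
  have h := bose_le_two_mul_exp_neg hu
  have h1 : bose u ≤ 1 := by
    unfold bose
    rw [div_le_one (by linarith [Real.add_one_le_exp u])]
    linarith [Real.add_one_le_exp u]
  have : (1 + bose u) ^ 2 ≤ 4 := by nlinarith
  unfold heatTrace
  nlinarith

lemma continuousOn_heatTrace : ContinuousOn heatTrace (Set.Ioi 0) := by
  have : ContinuousOn bose (Set.Ioi 0) := by
    unfold bose
    refine ContinuousOn.div continuousOn_const (by fun_prop) fun u hu => ?_
    have := Real.add_one_lt_exp (ne_of_gt hu)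
    have hu' : 0 < u := hu
    linarith
  unfold heatTrace
  fun_prop

/-- The heat trace with its polar part at `0` removed and the constant term `-3/4` smoothly
compensated. -/
noncomputable def regHeatTrace (u : ℝ) : ℝ :=
  heatTrace u - (6 / u ^ 3 + 3 / u ^ 2 + 1 / u) + 3 / 4 * Real.exp (-u)

lemma continuousOn_regHeatTrace : ContinuousOn regHeatTrace (Set.Ioi 0) := by
  have := continuousOn_heatTrace
  unfold regHeatTrace
  refine (this.sub (((ContinuousOn.div ?_ ?_ ?_).add (ContinuousOn.div ?_ ?_ ?_)).add
    (ContinuousOn.div ?_ ?_ ?_))).add (by fun_prop) <;> first | fun_prop | skip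
  all_goals
    intro u hu
    have hu' : 0 < u := hu
    positivity

lemma abs_regHeatTrace_le_of_le_one {u : ℝ} (hu : 0 < u) (hu1 : u ≤ 1) :
    |regHeatTrace u| ≤ 201 * u := by
  have h := abs_heatTrace_sub_le hu hu1
  have h1 : 1 - u ≤ Real.exp (-u) := by linarith [Real.add_one_le_exp (-u)]
  have h2 : Real.exp (-u) ≤ 1 := Real.exp_le_one_iff.2 (by linarith)
  unfold regHeatTrace
  rw [abs_le] at *
  constructor <;> linarith [h.1, h.2]

lemma abs_regHeatTrace_le_of_one_le {u : ℝ} (hu : 1 ≤ u) : |regHeatTrace u| ≤ 201 / u := by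
  have hu0 : 0 < u := lt_of_lt_of_le one_pos hu
  have h := heatTrace_le_exp_neg hu
  have h0 := heatTrace_pos hu0
  have hexp : Real.exp (-u) ≤ 1 / u := by
    rw [Real.exp_neg, ← one_div]
    exact one_div_le_one_div_of_le hu0 (by linarith [Real.add_one_le_exp u])
  have h2 : 1 / u ^ 2 ≤ 1 / u := one_div_le_one_div_of_le hu0 (by nlinarith)
  have h3 : 1 / u ^ 3 ≤ 1 / u := one_div_le_one_div_of_le hu0 (by nlinarith [pow_pos hu0 3])
  have e : regHeatTrace u = heatTrace u - (6 * (1 / u ^ 3) + 3 * (1 / u ^ 2) + 1 / u)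
      + 3 / 4 * Real.exp (-u) := by unfold regHeatTrace; ring
  have := Real.exp_pos (-u)
  have p1 : 0 < 1 / u := by positivity
  have p2 : 0 < 1 / u ^ 2 := by positivity
  have p3 : 0 < 1 / u ^ 3 := by positivity
  rw [e, show 201 / u = 201 * (1 / u) by ring, abs_le]
  constructor <;> linarith

/-- The heat trace `∑_{m ≥ 1} (3m² + 3m + 1) e^{-ms}` at a complex argument, in closed form. -/
noncomputable def heatTraceC (s : ℂ) : ℂ :=
  6 * (1 / (Complex.exp s - 1)) * (1 + 1 / (Complex.exp s - 1)) ^ 2 + 1 / (Complex.exp s - 1)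

lemma ofReal_heatTrace (u : ℝ) : (heatTrace u : ℂ) = heatTraceC u := by
  simp [heatTrace, heatTraceC, bose]

/-- The number `(m + 2)³ - (m + 1)³` of `ℓ` with `⌊ℓ^{1/3}⌋ = m + 1`. -/
def partMult (m : ℕ) : ℕ := 3 * (m + 1) ^ 2 + 3 * (m + 1) + 1

lemma norm_exp_neg_lt_one {s : ℂ} (hs : 0 < s.re) : ‖Complex.exp (-s)‖ < 1 := by
  rw [Complex.norm_exp, Complex.neg_re]
  exact Real.exp_lt_one_iff.2 (by linarith)

/-- Closed form of the heat trace in terms of `z = e^{-s}`. -/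
lemma heatTraceC_eq {s : ℂ} (hs : 0 < s.re) :
    heatTraceC s = 6 * (Complex.exp (-s) / (1 - Complex.exp (-s)) ^ 3) +
      Complex.exp (-s) / (1 - Complex.exp (-s)) := by
  have hz := norm_exp_neg_lt_one hs
  have h1 : 1 - Complex.exp (-s) ≠ 0 := by
    intro h
    rw [sub_eq_zero] at h
    rw [← h] at hz
    simp at hz
  have hE : Complex.exp s = (Complex.exp (-s))⁻¹ := by rw [Complex.exp_neg, inv_inv]
  have h0 := Complex.exp_ne_zero (-s)
  have hb : 1 / (Complex.exp s - 1) = Complex.exp (-s) / (1 - Complex.exp (-s)) := by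
    rw [hE]
    set z := Complex.exp (-s)
    have : z⁻¹ - 1 ≠ 0 := by
      intro h
      apply h1
      field_simp at h
      simpa using h
    field_simp
  unfold heatTraceC
  rw [hb]
  set z := Complex.exp (-s)
  field_simp
  ring

lemma hasSum_heatTraceC {s : ℂ} (hs : 0 < s.re) :
    HasSum (fun m : ℕ => (partMult m : ℂ) * Complex.exp (-((m + 1 : ℕ) * s))) (heatTraceC s) := by
  have hz := norm_exp_neg_lt_one hs
  rw [heatTraceC_eq hs]
  have h2 := (hasSum_choose_mul_geometric_of_norm_lt_one 2 hz).mul_left (6 * Complex.exp (-s))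
  have h1 := (hasSum_geometric_of_norm_lt_one hz).mul_left (Complex.exp (-s))
  convert! h2.add h1 using 1
  · funext m
    have e : Complex.exp (-((m + 1 : ℕ) * s)) = Complex.exp (-s) * Complex.exp (-s) ^ m := by
      rw [← pow_succ', ← Complex.exp_nat_mul]
      congr 1
      ring
    have c : ((m + 2).choose 2 : ℂ) = (m + 2) * (m + 1) / 2 := by
      rw [Nat.cast_choose_two]
      push_cast
      ring
    rw [e, c, partMult]
    push_cast
    ring
  · ring

lemma hasSum_heatTrace {u : ℝ} (hu : 0 < u) :
    HasSum (fun m : ℕ => (partMult m : ℝ) * Real.exp (-((m + 1 : ℕ) * u))) (heatTrace u) := by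
  have := hasSum_heatTraceC (s := (u : ℂ)) (by simpa using hu)
  rw [← ofReal_heatTrace, ← Complex.hasSum_ofReal] at *
  convert! this using 2
  push_cast
  rfl

/-- The Dirichlet series `∑_{ℓ ≥ 1} ⌊ℓ^{1/3}⌋^{-s}`, continued analytically. -/
noncomputable def partZeta (s : ℂ) : ℂ :=
  3 * riemannZeta (s - 2) + 3 * riemannZeta (s - 1) + riemannZeta s

lemma hasSum_partZeta {s : ℂ} (hs : 3 < s.re) :
    HasSum (fun m : ℕ => (partMult m : ℂ) / (m + 1 : ℂ) ^ s) (partZeta s) := by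
  have key : ∀ w : ℂ, 1 < w.re →
      HasSum (fun m : ℕ => 1 / (m + 1 : ℂ) ^ w) (riemannZeta w) := fun w hw => by
    rw [zeta_eq_tsum_one_div_nat_add_one_cpow hw]
    refine Summable.hasSum ?_
    have := (summable_nat_add_iff 1).2 (Complex.summable_one_div_nat_cpow.2 hw)
    simpa using this
  convert! (((key (s - 2) (by simp; linarith)).mul_left 3).add
    ((key (s - 1) (by simp; linarith)).mul_left 3)).add (key s (by linarith)) using 1
  funext m
  have hm : (m + 1 : ℂ) ≠ 0 := by exact_mod_cast Nat.succ_ne_zero m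
  rw [Complex.cpow_sub _ _ hm, Complex.cpow_sub _ _ hm, Complex.cpow_one, partMult]
  have : (m + 1 : ℂ) ^ s ≠ 0 := by simp [Complex.cpow_eq_zero_iff, hm]
  have h2 : (m + 1 : ℂ) ^ (2 : ℂ) = (m + 1) ^ 2 := by exact_mod_cast Complex.cpow_natCast (m + 1) 2
  rw [h2]
  push_cast
  field_simp

lemma mellin_heatTrace {s : ℂ} (hs : 3 < s.re) :
    mellin (fun u => (heatTrace u : ℂ)) s = Complex.Gamma s * partZeta s := by
  have h := hasSum_mellin (a := fun m : ℕ => (partMult m : ℂ)) (p := fun m : ℕ => (m + 1 : ℝ))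
    (F := fun u => (heatTrace u : ℂ)) (s := s) (fun i => Or.inr (by positivity)) (by linarith) ?_ ?_
  · have h2 := (hasSum_partZeta hs).mul_left (Complex.Gamma s)
    refine h.unique ?_
    convert! h2 using 2 with m
    push_cast
    ring
  · intro t ht
    have := hasSum_heatTrace (show 0 < t from ht)
    rw [← Complex.hasSum_ofReal] at this
    convert! this using 2 with m
    push_cast
    ring_nf
  · have := (hasSum_partZeta (s := (s.re : ℂ)) (by simpa using hs)).summable.norm
    convert! this using 2 with m
    rw [norm_div]
    congr 1
    have : (m + 1 : ℂ) = ((m + 1 : ℝ) : ℂ) := by push_cast; rfl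
    rw [this, Complex.norm_cpow_eq_rpow_re_of_pos (by positivity)]
    simp

/-- The heat trace with its polar part removed on `(0, 1]` only. -/
noncomputable def truncHeatTrace (u : ℝ) : ℂ :=
  heatTrace u - (6 * (Set.Ioc 0 1).indicator (fun t : ℝ => (t : ℂ) ^ (-3 : ℂ)) u
    + 3 * (Set.Ioc 0 1).indicator (fun t : ℝ => (t : ℂ) ^ (-2 : ℂ)) u
    + (Set.Ioc 0 1).indicator (fun t : ℝ => (t : ℂ) ^ (-1 : ℂ)) u)

lemma truncHeatTrace_of_le_one {u : ℝ} (hu : 0 < u) (hu1 : u ≤ 1) :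
    truncHeatTrace u = ((heatTrace u - (6 / u ^ 3 + 3 / u ^ 2 + 1 / u) : ℝ) : ℂ) := by
  have hmem : u ∈ Set.Ioc (0 : ℝ) 1 := ⟨hu, hu1⟩
  have h3 : (u : ℂ) ^ (-3 : ℂ) = 1 / (u : ℂ) ^ 3 := by
    rw [Complex.cpow_neg, one_div]; norm_cast
  have h2 : (u : ℂ) ^ (-2 : ℂ) = 1 / (u : ℂ) ^ 2 := by
    rw [Complex.cpow_neg, one_div]; norm_cast
  have h1 : (u : ℂ) ^ (-1 : ℂ) = 1 / (u : ℂ) := by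
    rw [Complex.cpow_neg_one, one_div]
  simp only [truncHeatTrace, Set.indicator_of_mem hmem, h3, h2, h1]
  push_cast
  ring

lemma truncHeatTrace_of_one_lt {u : ℝ} (hu : 1 < u) : truncHeatTrace u = heatTrace u := by
  have hmem : u ∉ Set.Ioc (0 : ℝ) 1 := fun h => absurd h.2 (not_le.2 hu)
  simp [truncHeatTrace, Set.indicator_of_notMem hmem]

lemma locallyIntegrableOn_truncHeatTrace :
    MeasureTheory.LocallyIntegrableOn truncHeatTrace (Set.Ioi 0) := by
  have hi : ∀ a : ℂ, MeasureTheory.LocallyIntegrableOn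
      ((Set.Ioc 0 1).indicator (fun t : ℝ => (t : ℂ) ^ a)) (Set.Ioi 0) := fun a => by
    have hc : ContinuousOn (fun t : ℝ => (t : ℂ) ^ a) (Set.Ioi 0) := fun t ht =>
      (Complex.continuousAt_ofReal_cpow_const t a (Or.inr (ne_of_gt ht))).continuousWithinAt
    have hl := hc.locallyIntegrableOn measurableSet_Ioi (μ := MeasureTheory.volume)
    intro x hx
    obtain ⟨s, hs, hInt⟩ := hl x hx
    exact ⟨s, hs, MeasureTheory.IntegrableOn.indicator hInt measurableSet_Ioc⟩
  have hh : MeasureTheory.LocallyIntegrableOn (fun u => (heatTrace u : ℂ)) (Set.Ioi 0) :=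
    (Complex.continuous_ofReal.comp_continuousOn continuousOn_heatTrace).locallyIntegrableOn
      measurableSet_Ioi
  have := hh.sub (((((hi (-3)).smul (6 : ℂ))).add ((hi (-2)).smul (3 : ℂ))).add (hi (-1)))
  exact this

lemma truncHeatTrace_isBigO_atTop :
    truncHeatTrace =O[atTop] fun t => Real.exp (-1 * t) := by
  refine Asymptotics.IsBigO.of_bound 50 ?_
  filter_upwards [eventually_gt_atTop 1] with u hu
  rw [truncHeatTrace_of_one_lt hu, Complex.norm_real, Real.norm_eq_abs,
    abs_of_pos (heatTrace_pos (by linarith)), Real.norm_eq_abs, Real.abs_exp, neg_one_mul]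
  exact heatTrace_le_exp_neg hu.le

lemma truncHeatTrace_isBigO_zero :
    truncHeatTrace =O[𝓝[>] 0] fun t : ℝ => t ^ (-(0 : ℝ)) := by
  refine Asymptotics.IsBigO.of_bound 201 ?_
  filter_upwards [Ioc_mem_nhdsGT (zero_lt_one (α := ℝ))] with u hu
  rw [truncHeatTrace_of_le_one hu.1 hu.2, Complex.norm_real, Real.norm_eq_abs]
  simp only [neg_zero, Real.rpow_zero, norm_one, mul_one]
  have h := abs_heatTrace_sub_le hu.1 hu.2
  have := hu.2
  rw [abs_le] at *
  constructor <;> linarith [h.1, h.2]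

lemma mellinConvergent_truncHeatTrace {s : ℂ} (hs : 0 < s.re) :
    MellinConvergent truncHeatTrace s :=
  mellinConvergent_of_isBigO_rpow_exp one_pos locallyIntegrableOn_truncHeatTrace
    truncHeatTrace_isBigO_atTop truncHeatTrace_isBigO_zero hs

lemma differentiableAt_mellin_truncHeatTrace {s : ℂ} (hs : 0 < s.re) :
    DifferentiableAt ℂ (mellin truncHeatTrace) s :=
  mellin_differentiableAt_of_isBigO_rpow_exp one_pos locallyIntegrableOn_truncHeatTrace
    truncHeatTrace_isBigO_atTop truncHeatTrace_isBigO_zero hs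

lemma mellin_truncHeatTrace_of_three_lt {s : ℂ} (hs : 3 < s.re) :
    mellin truncHeatTrace s + (6 / (s - 3) + 3 / (s - 2) + 1 / (s - 1)) =
      Complex.Gamma s * partZeta s := by
  have h3 := hasMellin_cpow_Ioc (-3) (s := s) (by simp; linarith)
  have h2 := hasMellin_cpow_Ioc (-2) (s := s) (by simp; linarith)
  have h1 := hasMellin_cpow_Ioc (-1) (s := s) (by simp; linarith)
  have h32 := hasMellin_add (h3.1.const_smul (6 : ℂ)) (h2.1.const_smul (3 : ℂ))
  have hp := hasMellin_add h32.1 h1.1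
  have hsum := hasMellin_add (mellinConvergent_truncHeatTrace (s := s) (by linarith)) hp.1
  rw [hp.2, h32.2, mellin_const_smul, mellin_const_smul, h3.2, h2.2, h1.2] at hsum
  rw [← mellin_heatTrace hs]
  simp only [smul_eq_mul, mul_one_div, ← sub_eq_add_neg] at hsum
  rw [← hsum.2]
  congr 1
  funext u
  simp only [truncHeatTrace]
  ring

lemma differentiableAt_partZeta {s : ℂ} (h1 : s ≠ 1) (h2 : s ≠ 2) (h3 : s ≠ 3) :
    DifferentiableAt ℂ partZeta s := by
  have e0 : DifferentiableAt ℂ riemannZeta s := differentiableAt_riemannZeta h1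
  have e1 : DifferentiableAt ℂ (fun s => riemannZeta (s - 1)) s :=
    DifferentiableAt.comp (f := fun s : ℂ => s - 1) s
      (differentiableAt_riemannZeta (fun h => h2 (by linear_combination h))) (by fun_prop)
  have e2 : DifferentiableAt ℂ (fun s => riemannZeta (s - 2)) s :=
    DifferentiableAt.comp (f := fun s : ℂ => s - 2) s
      (differentiableAt_riemannZeta (fun h => h3 (by linear_combination h))) (by fun_prop)
  unfold partZeta
  fun_prop

lemma mellin_truncHeatTrace_of_im_pos {s : ℂ} (hs : 0 < s.re) (him : 0 < s.im) :
    mellin truncHeatTrace s + (6 / (s - 3) + 3 / (s - 2) + 1 / (s - 1)) =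
      Complex.Gamma s * partZeta s := by
  have ho : IsOpen {s : ℂ | 0 < s.re ∧ 0 < s.im} :=
    (isOpen_lt continuous_const Complex.continuous_re).inter
      (isOpen_lt continuous_const Complex.continuous_im)
  have hc : Convex ℝ {s : ℂ | 0 < s.re ∧ 0 < s.im} :=
    (convex_halfSpace_re_gt 0).inter (convex_halfSpace_im_gt 0)
  have hne : ∀ {s : ℂ}, 0 < s.im → ∀ r : ℝ, s ≠ r := fun h r hr => by simp [hr] at h
  have hf : AnalyticOnNhd ℂ
      (fun s => mellin truncHeatTrace s + (6 / (s - 3) + 3 / (s - 2) + 1 / (s - 1)))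
      {s : ℂ | 0 < s.re ∧ 0 < s.im} := by
    refine DifferentiableOn.analyticOnNhd (fun s hs => ?_) ho
    have h1 : s - 1 ≠ 0 := sub_ne_zero.2 (by exact_mod_cast hne hs.2 1)
    have h2 : s - 2 ≠ 0 := sub_ne_zero.2 (by exact_mod_cast hne hs.2 2)
    have h3 : s - 3 ≠ 0 := sub_ne_zero.2 (by exact_mod_cast hne hs.2 3)
    have := differentiableAt_mellin_truncHeatTrace hs.1
    exact DifferentiableAt.differentiableWithinAt (by fun_prop (disch := assumption))
  have hg : AnalyticOnNhd ℂ (fun s => Complex.Gamma s * partZeta s)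
      {s : ℂ | 0 < s.re ∧ 0 < s.im} := by
    refine DifferentiableOn.analyticOnNhd (fun s hs => ?_) ho
    have h1 := differentiableAt_partZeta (s := s) (by exact_mod_cast hne hs.2 1)
      (by exact_mod_cast hne hs.2 2) (by exact_mod_cast hne hs.2 3)
    have h2 : DifferentiableAt ℂ Complex.Gamma s := by
      refine Complex.differentiableAt_Gamma s fun m => ?_
      exact_mod_cast hne hs.2 (-m)
    exact (h2.mul h1).differentiableWithinAt
  refine hf.eqOn_of_preconnected_of_eventuallyEq hg hc.isPreconnected (z₀ := 4 + Complex.I)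
    (by simp) ?_ ⟨hs, him⟩
  have : {s : ℂ | 3 < s.re} ∈ 𝓝 (4 + Complex.I) :=
    (isOpen_lt continuous_const Complex.continuous_re).mem_nhds (by norm_num)
  filter_upwards [this] with s hs
  exact mellin_truncHeatTrace_of_three_lt hs

lemma mellin_truncHeatTrace {s : ℝ} (hs : 0 < s) (hs1 : s < 1) :
    mellin truncHeatTrace s + (6 / (s - 3) + 3 / (s - 2) + 1 / (s - 1)) =
      Complex.Gamma s * partZeta s := by
  have hlim : Tendsto (fun ε : ℝ => (s : ℂ) + ε * Complex.I) (𝓝[>] 0) (𝓝 s) := by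
    have : Tendsto (fun ε : ℝ => (s : ℂ) + ε * Complex.I) (𝓝 0) (𝓝 (s + (0 : ℝ) * Complex.I)) :=
      Continuous.tendsto (by fun_prop) 0
    simpa using this.mono_left nhdsWithin_le_nhds
  have hne : ∀ r : ℝ, s ≠ r → (s : ℂ) ≠ r := fun r h => by exact_mod_cast h
  have n1 : (s : ℂ) ≠ 1 := by exact_mod_cast hne 1 (by linarith)
  have n2 : (s : ℂ) ≠ 2 := by exact_mod_cast hne 2 (by linarith)
  have n3 : (s : ℂ) ≠ 3 := by exact_mod_cast hne 3 (by linarith)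
  have h1 : (s : ℂ) - 1 ≠ 0 := sub_ne_zero.2 n1
  have h2 : (s : ℂ) - 2 ≠ 0 := sub_ne_zero.2 n2
  have h3 : (s : ℂ) - 3 ≠ 0 := sub_ne_zero.2 n3
  have hf : ContinuousAt
      (fun s => mellin truncHeatTrace s + (6 / (s - 3) + 3 / (s - 2) + 1 / (s - 1))) (s : ℂ) := by
    have := differentiableAt_mellin_truncHeatTrace (s := s) (by simpa using hs)
    exact DifferentiableAt.continuousAt (𝕜 := ℂ) (by fun_prop (disch := assumption))
  have hg : ContinuousAt (fun s => Complex.Gamma s * partZeta s) (s : ℂ) := by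
    have h2 : DifferentiableAt ℂ Complex.Gamma s := by
      refine Complex.differentiableAt_Gamma s fun m => ?_
      have := hne (-m) (by have : (0 : ℝ) ≤ m := m.cast_nonneg
                           linarith)
      exact_mod_cast this
    exact (h2.mul (differentiableAt_partZeta n1 n2 n3)).continuousAt
  refine tendsto_nhds_unique ((hf.tendsto.comp hlim).congr' ?_) (hg.tendsto.comp hlim)
  filter_upwards [self_mem_nhdsWithin] with ε hε
  exact mellin_truncHeatTrace_of_im_pos (by simpa using hs) (by simpa using hε)

lemma integral_lincomb {f g₃ g₂ g₁ h : ℝ → ℂ} {μ : MeasureTheory.Measure ℝ}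
    (hf : MeasureTheory.Integrable f μ) (h₃ : MeasureTheory.Integrable g₃ μ)
    (h₂ : MeasureTheory.Integrable g₂ μ) (h₁ : MeasureTheory.Integrable g₁ μ)
    (hh : MeasureTheory.Integrable h μ) :
    ∫ u, (f u - (6 * g₃ u + 3 * g₂ u + g₁ u) + 3 / 4 * h u) ∂μ =
      ∫ u, f u ∂μ - (6 * ∫ u, g₃ u ∂μ + 3 * ∫ u, g₂ u ∂μ + ∫ u, g₁ u ∂μ)
        + 3 / 4 * ∫ u, h u ∂μ := by
  have i32 : MeasureTheory.Integrable (fun u => 6 * g₃ u + 3 * g₂ u) μ :=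
    (h₃.const_mul 6).add (h₂.const_mul 3)
  have i321 : MeasureTheory.Integrable (fun u => 6 * g₃ u + 3 * g₂ u + g₁ u) μ := i32.add h₁
  have iall : MeasureTheory.Integrable (fun u => f u - (6 * g₃ u + 3 * g₂ u + g₁ u)) μ :=
    hf.sub i321
  rw [MeasureTheory.integral_add iall (hh.const_mul _), MeasureTheory.integral_sub hf i321,
    MeasureTheory.integral_add i32 h₁,
    MeasureTheory.integral_add (h₃.const_mul 6) (h₂.const_mul 3)]
  simp only [MeasureTheory.integral_const_mul]

lemma integral_rpow_mul_regHeatTrace {s : ℝ} (hs : 0 < s) (hs1 : s < 1) :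
    ((∫ u in Set.Ioi (0 : ℝ), u ^ (s - 1) * regHeatTrace u : ℝ) : ℂ) =
      Complex.Gamma s * (partZeta s + 3 / 4) := by
  have hT := mellinConvergent_truncHeatTrace (s := (s : ℂ)) (by simpa using hs)
  have hG := Complex.GammaIntegral_convergent (s := (s : ℂ)) (by simpa using hs)
  have hi : ∀ k : ℕ, 1 ≤ k →
      MeasureTheory.IntegrableOn (fun u : ℝ => (u : ℂ) ^ ((s : ℂ) - 1 - k)) (Set.Ioi 1) ∧
      ∫ u in Set.Ioi (1 : ℝ), (u : ℂ) ^ ((s : ℂ) - 1 - k) = -1 / (s - k) := fun k hk => by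
    have hk' : (1 : ℝ) ≤ k := by exact_mod_cast hk
    have hre : ((s : ℂ) - 1 - k).re < -1 := by simp; linarith
    refine ⟨integrableOn_Ioi_cpow_of_lt hre one_pos, ?_⟩
    rw [integral_Ioi_cpow_of_lt hre one_pos]
    simp
    ring
  have hind : ∀ k : ℕ, 1 ≤ k →
      MeasureTheory.IntegrableOn
        ((Set.Ioi (1 : ℝ)).indicator fun u : ℝ => (u : ℂ) ^ ((s : ℂ) - 1 - k)) (Set.Ioi 0) ∧
      ∫ u in Set.Ioi (0 : ℝ), (Set.Ioi (1 : ℝ)).indicator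
        (fun u : ℝ => (u : ℂ) ^ ((s : ℂ) - 1 - k)) u = -1 / (s - k) := fun k hk => by
    have hsub : Set.Ioi (1 : ℝ) ∩ Set.Ioi 0 = Set.Ioi 1 :=
      Set.inter_eq_left.2 (Set.Ioi_subset_Ioi zero_le_one)
    refine ⟨?_, ?_⟩
    · exact ((MeasureTheory.integrable_indicator_iff measurableSet_Ioi).2 (hi k hk).1).integrableOn
    · rw [MeasureTheory.integral_indicator measurableSet_Ioi,
        MeasureTheory.Measure.restrict_restrict measurableSet_Ioi, hsub]
      exact (hi k hk).2
  obtain ⟨i1, v1⟩ := hind 1 le_rfl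
  obtain ⟨i2, v2⟩ := hind 2 one_le_two
  obtain ⟨i3, v3⟩ := hind 3 (by norm_num)
  have hdecomp : ∀ u ∈ Set.Ioi (0 : ℝ), ((u ^ (s - 1) * regHeatTrace u : ℝ) : ℂ) =
      (u : ℂ) ^ ((s : ℂ) - 1) • truncHeatTrace u
      - (6 * (Set.Ioi (1 : ℝ)).indicator (fun u : ℝ => (u : ℂ) ^ ((s : ℂ) - 1 - (3 : ℕ))) u
        + 3 * (Set.Ioi (1 : ℝ)).indicator (fun u : ℝ => (u : ℂ) ^ ((s : ℂ) - 1 - (2 : ℕ))) u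
        + (Set.Ioi (1 : ℝ)).indicator (fun u : ℝ => (u : ℂ) ^ ((s : ℂ) - 1 - (1 : ℕ))) u)
      + 3 / 4 * ((Real.exp (-u) : ℝ) * (u : ℂ) ^ ((s : ℂ) - 1)) := by
    intro u hu
    have hu0 : 0 < u := hu
    have hu' : (u : ℂ) ≠ 0 := by exact_mod_cast hu0.ne'
    have hpow : ((u ^ (s - 1) : ℝ) : ℂ) = (u : ℂ) ^ ((s : ℂ) - 1) := by
      rw [Complex.ofReal_cpow hu0.le]; push_cast; rfl
    rw [Complex.ofReal_mul, hpow]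
    rcases le_or_gt u 1 with h1 | h1
    · rw [truncHeatTrace_of_le_one hu0 h1]
      have hn : u ∉ Set.Ioi (1 : ℝ) := not_lt.2 h1
      simp only [Set.indicator_of_notMem hn, regHeatTrace, smul_eq_mul]
      push_cast
      ring
    · rw [truncHeatTrace_of_one_lt h1]
      have hn : u ∈ Set.Ioi (1 : ℝ) := h1
      have hk : ∀ k : ℕ, (u : ℂ) ^ ((s : ℂ) - 1 - k) = (u : ℂ) ^ ((s : ℂ) - 1) / (u : ℂ) ^ k :=
        fun k => by rw [Complex.cpow_sub _ _ hu', Complex.cpow_natCast]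
      simp only [Set.indicator_of_mem hn, regHeatTrace, smul_eq_mul, hk]
      push_cast
      ring
  rw [← integral_complex_ofReal, MeasureTheory.setIntegral_congr_fun measurableSet_Ioi hdecomp,
    integral_lincomb hT i3 i2 i1 hG, v1, v2, v3]
  have hGam := Complex.Gamma_eq_integral (s := (s : ℂ)) (by simpa using hs)
  rw [Complex.GammaIntegral] at hGam
  have hm := mellin_truncHeatTrace hs hs1
  rw [mellin] at hm
  rw [← hGam, mul_add, ← hm]
  push_cast
  ring

lemma riemannZeta_neg_one : riemannZeta (-1) = -1 / 12 := by
  have := riemannZeta_neg_nat_eq_bernoulli 1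
  norm_num [bernoulli_two] at this
  rw [this]
  norm_num

lemma riemannZeta_neg_two : riemannZeta (-2) = 0 := by
  simpa using riemannZeta_neg_two_mul_nat_add_one 0

lemma partZeta_zero : partZeta 0 = -3 / 4 := by
  simp only [partZeta, zero_sub, riemannZeta_neg_one, riemannZeta_neg_two, riemannZeta_zero]
  norm_num

lemma hasDerivAt_partZeta_zero :
    HasDerivAt partZeta (3 * deriv riemannZeta (-2) + 3 * deriv riemannZeta (-1)
      + deriv riemannZeta 0) 0 := by
  have h : ∀ a : ℂ, -a ≠ 1 →
      HasDerivAt (fun s => riemannZeta (s - a)) (deriv riemannZeta (-a)) 0 := fun a ha => by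
    have := HasDerivAt.comp_sub_const (0 : ℂ) a (f := riemannZeta) (f' := deriv riemannZeta (-a))
      (by rw [zero_sub]; exact (differentiableAt_riemannZeta ha).hasDerivAt)
    exact this
  have h0 := (differentiableAt_riemannZeta (s := 0) (by norm_num)).hasDerivAt
  exact (((h 2 (by norm_num)).const_mul 3).add ((h 1 (by norm_num)).const_mul 3)).add h0

lemma deriv_riemannZeta_neg_two :
    deriv riemannZeta (-2) = -riemannZeta 3 / (4 * π ^ 2) := by
  have hnat : ∀ n : ℕ, (3 : ℂ) ≠ -n := fun n h => by
    have : ((3 + n : ℕ) : ℂ) = 0 := by push_cast; rw [h]; ring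
    rw [Nat.cast_eq_zero] at this
    omega
  have hev : (fun s => riemannZeta (1 - s)) =ᶠ[𝓝 (3 : ℂ)] fun s =>
      Complex.cos (π * s / 2) * (2 * (2 * π : ℂ) ^ (-s) * Complex.Gamma s * riemannZeta s) := by
    have : {s : ℂ | 1 < s.re} ∈ 𝓝 (3 : ℂ) :=
      (isOpen_lt continuous_const Complex.continuous_re).mem_nhds (by norm_num)
    filter_upwards [this] with s hs
    rw [riemannZeta_one_sub]
    · ring
    · intro n h
      have hs' : 1 < s.re := hs
      rw [h] at hs'
      simp at hs'
      have : (0 : ℝ) ≤ n := n.cast_nonneg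
      linarith
    · intro h
      have hs' : 1 < s.re := hs
      simp [h] at hs'
  have hL : HasDerivAt (fun s => riemannZeta (1 - s)) (-deriv riemannZeta (-2)) 3 := by
    have h := (differentiableAt_riemannZeta (s := -2) (by norm_num)).hasDerivAt
    have := HasDerivAt.comp_const_sub (1 : ℂ) 3 (f := riemannZeta) (f' := deriv riemannZeta (-2))
      (by convert! h using 1; norm_num)
    exact this
  have hcos : HasDerivAt (fun s : ℂ => Complex.cos (π * s / 2)) (π / 2) 3 := by
    have h1 : HasDerivAt (fun s : ℂ => π * s / 2) (π / 2 : ℂ) 3 := by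
      simpa using ((hasDerivAt_id (3 : ℂ)).const_mul (π : ℂ)).div_const 2
    have := h1.ccos
    convert! this using 1
    have : (π * 3 / 2 : ℂ) = π / 2 + π := by ring
    rw [this, Complex.sin_add_pi, Complex.sin_pi_div_two]
    ring
  have hcos0 : Complex.cos (π * 3 / 2) = 0 := by
    have : (π * 3 / 2 : ℂ) = π / 2 + π := by ring
    rw [this, Complex.cos_add_pi, Complex.cos_pi_div_two, neg_zero]
  have h2π : (2 * π : ℂ) ≠ 0 := by simp [Real.pi_ne_zero]
  have hd : DifferentiableAt ℂ
      (fun s => 2 * (2 * π : ℂ) ^ (-s) * Complex.Gamma s * riemannZeta s) 3 := by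
    have hz := differentiableAt_riemannZeta (s := 3) (by norm_num)
    have hΓ := Complex.differentiableAt_Gamma 3 hnat
    have hp : DifferentiableAt ℂ (fun s : ℂ => (2 * π : ℂ) ^ (-s)) 3 :=
      DifferentiableAt.const_cpow (by fun_prop) (Or.inl h2π)
    fun_prop
  have hR := hcos.mul hd.hasDerivAt
  have := (hL.congr_of_eventuallyEq hev.symm).unique hR
  have hG3 : Complex.Gamma 3 = 2 := by
    have := Complex.Gamma_nat_eq_factorial 2
    rw [show ((2 : ℕ) : ℂ) + 1 = 3 by norm_num] at this
    rw [this]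
    norm_num [Nat.factorial]
  have hpow : (2 * π : ℂ) ^ (-(3 : ℂ)) = 1 / (2 * π) ^ 3 := by
    rw [Complex.cpow_neg, one_div]
    norm_cast
  rw [hcos0, hG3, hpow] at this
  have hπ : (π : ℂ) ≠ 0 := by simp [Real.pi_ne_zero]
  have h' : deriv riemannZeta (-2) =
      -(π / 2 * (2 * (1 / (2 * π) ^ 3) * 2 * riemannZeta 3)) := by linear_combination -this
  rw [h']
  field_simp
  ring

/-- The value at `0` of the derivative of `partZeta`. -/
noncomputable def partZetaDeriv : ℝ :=
  -3 * realZeta 3 / (4 * π ^ 2) + 3 * realZetaDeriv (-1) - Real.log (2 * π) / 2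

lemma re_deriv_partZeta :
    (3 * deriv riemannZeta (-2) + 3 * deriv riemannZeta (-1) + deriv riemannZeta 0).re =
      partZetaDeriv := by
  have hlog : Complex.log (2 * π) = ((Real.log (2 * π) : ℝ) : ℂ) := by
    rw [Complex.ofReal_log (by positivity)]
    push_cast
    rfl
  have h2 : (-riemannZeta 3 / (4 * π ^ 2) : ℂ).re = -realZeta 3 / (4 * π ^ 2) := by
    have : (4 * π ^ 2 : ℂ) = ((4 * π ^ 2 : ℝ) : ℂ) := by push_cast; rfl
    rw [this, Complex.div_ofReal_re]
    simp [realZeta]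
  have h0 : (-Complex.log (2 * π) / 2 : ℂ).re = -Real.log (2 * π) / 2 := by
    rw [hlog]
    simp
  have h3 : ∀ z : ℂ, (3 * z).re = 3 * z.re := fun z => by simp
  rw [deriv_riemannZeta_neg_two, deriv_riemannZeta_zero, Complex.add_re, Complex.add_re, h3, h3,
    h2, h0, partZetaDeriv, realZetaDeriv]
  push_cast
  ring

lemma lt_floor_succ_mul {t u : ℝ} (ht : 0 < t) : u < (⌊u / t⌋₊ + 1 : ℝ) * t := by
  rw [← div_lt_iff₀ ht]
  exact Nat.lt_floor_add_one _

lemma floor_succ_mul_le {t u : ℝ} (ht : 0 < t) (hu : 0 < u) :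
    (⌊u / t⌋₊ + 1 : ℝ) * t ≤ u + t := by
  have h := Nat.floor_le (show 0 ≤ u / t by positivity)
  rw [le_div_iff₀ ht] at h
  linarith

/-- The right-endpoint Riemann sums over `(0, ∞)` of a function that is dominated by an antitone
integrable one are integrals of step functions. -/
lemma hasSum_riemann_step {q E : ℝ → ℝ} {t : ℝ} (ht : 0 < t)
    (hE : AntitoneOn E (Set.Ioi 0)) (hEi : MeasureTheory.IntegrableOn E (Set.Ioi 0))
    (hqE : ∀ u, 0 < u → |q u| ≤ E u) :
    HasSum (fun k : ℕ => t * q ((k + 1) * t))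
      (∫ u in Set.Ioi (0 : ℝ), q ((⌊u / t⌋₊ + 1) * t)) := by
  have hmeas : Measurable fun u : ℝ => q ((⌊u / t⌋₊ + 1) * t) :=
    (measurable_from_nat (f := fun k : ℕ => q ((k + 1) * t))).comp
      (Nat.measurable_floor.comp (measurable_id.div_const t))
  have hInt : MeasureTheory.IntegrableOn (fun u : ℝ => q ((⌊u / t⌋₊ + 1) * t)) (Set.Ioi 0) := by
    refine MeasureTheory.Integrable.mono' hEi hmeas.aestronglyMeasurable ?_
    refine (MeasureTheory.ae_restrict_iff' measurableSet_Ioi).2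
      (MeasureTheory.ae_of_all _ fun u hu => ?_)
    have h1 := lt_floor_succ_mul (u := u) ht
    have hu' : (0 : ℝ) < u := hu
    exact (hqE _ (hu'.trans h1)).trans (hE hu (hu'.trans h1) h1.le)
  have hU : (⋃ k : ℕ, Set.Ico ((k : ℝ) * t) ((k + 1) * t)) = Set.Ici 0 := by
    ext u
    simp only [Set.mem_iUnion, Set.mem_Ico, Set.mem_Ici]
    constructor
    · rintro ⟨k, h, -⟩
      exact le_trans (by positivity) h
    · intro hu
      refine ⟨⌊u / t⌋₊, ?_, lt_floor_succ_mul ht⟩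
      rw [← le_div_iff₀ ht]
      exact Nat.floor_le (by positivity)
  have hfl : ∀ (k : ℕ) (u : ℝ), u ∈ Set.Ico ((k : ℝ) * t) ((k + 1) * t) → ⌊u / t⌋₊ = k := by
    intro k u hu
    have h0 : 0 ≤ u / t := div_nonneg (le_trans (by positivity) hu.1) ht.le
    rw [Nat.floor_eq_iff h0, le_div_iff₀ ht, div_lt_iff₀ ht]
    exact hu
  have hd : Pairwise (Function.onFun Disjoint
      fun k : ℕ => Set.Ico ((k : ℝ) * t) ((k + 1) * t)) := by
    intro i j hij
    refine Set.disjoint_left.2 fun u hi hj => hij ?_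
    rw [← hfl i u hi, hfl j u hj]
  have hs := MeasureTheory.hasSum_integral_iUnion
    (f := fun u : ℝ => q ((⌊u / t⌋₊ + 1) * t)) (μ := MeasureTheory.volume)
    (fun k : ℕ => (measurableSet_Ico : MeasurableSet (Set.Ico ((k : ℝ) * t) ((k + 1) * t)))) hd
    (by rw [hU]; exact (integrableOn_Ici_iff_integrableOn_Ioi (by simp)).2 hInt)
  rw [hU, MeasureTheory.integral_Ici_eq_integral_Ioi] at hs
  convert! hs using 2 with k
  rw [MeasureTheory.setIntegral_congr_fun measurableSet_Ico
    (g := fun _ => q ((k + 1) * t)) (fun u hu => by simp only [hfl k u hu])]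
  simp
  left
  rw [max_eq_left (by linarith)]
  ring

lemma tendsto_riemann_sum {q E : ℝ → ℝ} (hq : ContinuousOn q (Set.Ioi 0))
    (hE : AntitoneOn E (Set.Ioi 0)) (hEi : MeasureTheory.IntegrableOn E (Set.Ioi 0))
    (hqE : ∀ u, 0 < u → |q u| ≤ E u) :
    Tendsto (fun t : ℝ => ∑' k : ℕ, t * q ((k + 1) * t)) (𝓝[>] 0)
      (𝓝 (∫ u in Set.Ioi (0 : ℝ), q u)) := by
  have : Tendsto (fun t : ℝ => ∫ u in Set.Ioi (0 : ℝ), q ((⌊u / t⌋₊ + 1) * t)) (𝓝[>] 0)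
      (𝓝 (∫ u in Set.Ioi (0 : ℝ), q u)) := by
    refine MeasureTheory.tendsto_integral_filter_of_dominated_convergence E ?_ ?_ hEi ?_
    · refine Eventually.of_forall fun t => Measurable.aestronglyMeasurable ?_
      exact (measurable_from_nat (f := fun k : ℕ => q ((k + 1) * t))).comp
        (Nat.measurable_floor.comp (measurable_id.div_const t))
    · filter_upwards [self_mem_nhdsWithin] with t ht
      refine (MeasureTheory.ae_restrict_iff' measurableSet_Ioi).2
        (MeasureTheory.ae_of_all _ fun u hu => ?_)
      have h1 := lt_floor_succ_mul (u := u) ht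
      have hu' : (0 : ℝ) < u := hu
      exact (hqE _ (hu'.trans h1)).trans (hE hu (hu'.trans h1) h1.le)
    · refine (MeasureTheory.ae_restrict_iff' measurableSet_Ioi).2
        (MeasureTheory.ae_of_all _ fun u hu => ?_)
      have hc : ContinuousAt q u := hq.continuousAt (Ioi_mem_nhds hu)
      refine hc.tendsto.comp ?_
      refine tendsto_of_tendsto_of_tendsto_of_le_of_le' (g := fun _ => u) (h := fun t => u + t)
        tendsto_const_nhds ?_ ?_ ?_
      · have : Tendsto (fun t : ℝ => u + t) (𝓝 0) (𝓝 (u + 0)) :=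
          (continuous_const.add continuous_id).tendsto 0
        rw [add_zero] at this
        exact this.mono_left nhdsWithin_le_nhds
      · filter_upwards [self_mem_nhdsWithin] with t ht using (lt_floor_succ_mul ht).le
      · filter_upwards [self_mem_nhdsWithin] with t ht using floor_succ_mul_le ht hu
  refine this.congr' ?_
  filter_upwards [self_mem_nhdsWithin] with t ht
  exact (hasSum_riemann_step ht hE hEi hqE).tsum_eq.symm

lemma abs_regHeatTrace_div_le {u : ℝ} (hu : 0 < u) :
    |regHeatTrace u / u| ≤ 402 * (1 + u ^ 2)⁻¹ := by
  rw [abs_div, abs_of_pos hu, ← div_eq_mul_inv, div_le_div_iff₀ hu (by positivity)]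
  rcases le_total u 1 with h | h
  · have := abs_regHeatTrace_le_of_le_one hu h
    calc |regHeatTrace u| * (1 + u ^ 2) ≤ 201 * u * 2 := by
          gcongr
          nlinarith
      _ = 402 * u := by ring
  · have := abs_regHeatTrace_le_of_one_le h
    calc |regHeatTrace u| * (1 + u ^ 2) ≤ 201 / u * (2 * u ^ 2) := by
          gcongr
          nlinarith
      _ = 402 * u := by field_simp; ring

lemma antitoneOn_inv_one_add_sq :
    AntitoneOn (fun u : ℝ => 402 * (1 + u ^ 2)⁻¹) (Set.Ioi 0) := by
  intro a ha b hb hab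
  have ha' : (0 : ℝ) < a := ha
  simp only
  gcongr

lemma continuousOn_regHeatTrace_div :
    ContinuousOn (fun u => regHeatTrace u / u) (Set.Ioi 0) :=
  continuousOn_regHeatTrace.div continuousOn_id fun _ hu => ne_of_gt hu

lemma integral_regHeatTrace_div : ∫ u in Set.Ioi (0 : ℝ), regHeatTrace u / u = partZetaDeriv := by
  have hdom : Tendsto (fun s : ℝ => ∫ u in Set.Ioi (0 : ℝ), u ^ (s - 1) * regHeatTrace u) (𝓝[>] 0)
      (𝓝 (∫ u in Set.Ioi (0 : ℝ), regHeatTrace u / u)) := by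
    refine MeasureTheory.tendsto_integral_filter_of_dominated_convergence
      (fun u => 201 * (Set.Ioc (0 : ℝ) 1).indicator (fun _ => 1) u
        + 201 * (Set.Ioi (1 : ℝ)).indicator (fun u => u ^ (-(3 / 2 : ℝ))) u) ?_ ?_ ?_ ?_
    · refine Eventually.of_forall fun s => ContinuousOn.aestronglyMeasurable ?_ measurableSet_Ioi
      refine ContinuousOn.mul (fun u hu => ?_) continuousOn_regHeatTrace
      exact (Real.continuousAt_rpow_const u _ (Or.inl (ne_of_gt hu))).continuousWithinAt
    · filter_upwards [Ioo_mem_nhdsGT (show (0 : ℝ) < 1 / 2 by norm_num)] with s hs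
      refine (MeasureTheory.ae_restrict_iff' measurableSet_Ioi).2
        (MeasureTheory.ae_of_all _ fun u hu => ?_)
      have hu' : (0 : ℝ) < u := hu
      rw [Real.norm_eq_abs, abs_mul, abs_of_pos (Real.rpow_pos_of_pos hu' _)]
      rcases le_or_gt u 1 with h | h
      · have h1 := abs_regHeatTrace_le_of_le_one hu' h
        have hmem : u ∈ Set.Ioc (0 : ℝ) 1 := ⟨hu', h⟩
        have hn : u ∉ Set.Ioi (1 : ℝ) := not_lt.2 h
        rw [Set.indicator_of_mem hmem, Set.indicator_of_notMem hn]
        calc u ^ (s - 1) * |regHeatTrace u| ≤ u ^ (s - 1) * (201 * u) := by gcongr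
          _ = 201 * (u ^ (s - 1) * u) := by ring
          _ = 201 * u ^ s := by rw [← Real.rpow_add_one hu'.ne', sub_add_cancel]
          _ ≤ 201 * 1 + 201 * 0 := by
            have := Real.rpow_le_one hu'.le h hs.1.le
            linarith
      · have h1 := abs_regHeatTrace_le_of_one_le h.le
        have hmem : u ∉ Set.Ioc (0 : ℝ) 1 := fun hh => absurd hh.2 (not_le.2 h)
        have hn : u ∈ Set.Ioi (1 : ℝ) := h
        rw [Set.indicator_of_notMem hmem, Set.indicator_of_mem hn]
        calc u ^ (s - 1) * |regHeatTrace u| ≤ u ^ (s - 1) * (201 / u) := by gcongr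
          _ = 201 * (u ^ (s - 1) / u) := by ring
          _ = 201 * u ^ (s - 1 - 1) := by rw [← Real.rpow_sub_one hu'.ne']
          _ ≤ 201 * u ^ (-(3 / 2 : ℝ)) := by
            gcongr
            · exact h.le
            · linarith [hs.2]
          _ = _ := by ring
    · refine MeasureTheory.Integrable.add ?_ ?_
      · refine MeasureTheory.Integrable.const_mul ?_ _
        refine MeasureTheory.Integrable.integrableOn ?_
        rw [MeasureTheory.integrable_indicator_iff measurableSet_Ioc]
        simp
      · refine MeasureTheory.Integrable.const_mul ?_ _
        refine MeasureTheory.Integrable.integrableOn ?_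
        rw [MeasureTheory.integrable_indicator_iff measurableSet_Ioi]
        exact integrableOn_Ioi_rpow_of_lt (by norm_num) one_pos
    · refine (MeasureTheory.ae_restrict_iff' measurableSet_Ioi).2
        (MeasureTheory.ae_of_all _ fun u hu => ?_)
      have hu' : (0 : ℝ) < u := hu
      have : Tendsto (fun s : ℝ => u ^ (s - 1) * regHeatTrace u) (𝓝 0)
          (𝓝 (u ^ ((0 : ℝ) - 1) * regHeatTrace u)) := by
        refine Continuous.tendsto (Continuous.mul ?_ continuous_const) 0
        exact continuous_const.rpow (by fun_prop) fun _ => Or.inl hu'.ne'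
      rw [zero_sub, Real.rpow_neg_one, ← div_eq_inv_mul] at this
      exact this.mono_left nhdsWithin_le_nhds
  have hcast : Tendsto (fun s : ℝ => (s : ℂ)) (𝓝[>] 0) (𝓝[≠] 0) := by
    refine tendsto_nhdsWithin_iff.2 ⟨?_, ?_⟩
    · exact (Complex.continuous_ofReal.tendsto 0).mono_left nhdsWithin_le_nhds
    · filter_upwards [self_mem_nhdsWithin] with s hs
      have : (0 : ℝ) < s := hs
      simpa using this.ne'
  have hslope := (hasDerivAt_iff_tendsto_slope.1 hasDerivAt_partZeta_zero).comp hcast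
  have hΓ : Tendsto (fun s : ℝ => Complex.Gamma (s + 1)) (𝓝[>] 0) (𝓝 1) := by
    have h1 : ContinuousAt Complex.Gamma 1 := by
      refine (Complex.differentiableAt_Gamma 1 fun m h => ?_).continuousAt
      have : ((1 + m : ℕ) : ℂ) = 0 := by push_cast; rw [h]; ring
      rw [Nat.cast_eq_zero] at this
      omega
    have h2 : Tendsto (fun s : ℝ => (s : ℂ) + 1) (𝓝[>] 0) (𝓝 1) := by
      have : Tendsto (fun s : ℝ => (s : ℂ) + 1) (𝓝 0) (𝓝 ((0 : ℝ) + 1)) :=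
        Continuous.tendsto (by fun_prop) 0
      simp only [Complex.ofReal_zero, zero_add] at this
      exact this.mono_left nhdsWithin_le_nhds
    have := h1.tendsto.comp h2
    rwa [Complex.Gamma_one] at this
  have hlim := (Complex.continuous_re.tendsto _).comp (hΓ.mul hslope)
  rw [one_mul, re_deriv_partZeta] at hlim
  refine tendsto_nhds_unique hdom (hlim.congr' ?_)
  filter_upwards [Ioo_mem_nhdsGT (zero_lt_one (α := ℝ))] with s hs
  have hs0 : (s : ℂ) ≠ 0 := by exact_mod_cast hs.1.ne'
  have h := congrArg Complex.re (integral_rpow_mul_regHeatTrace hs.1 hs.2)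
  rw [Complex.ofReal_re] at h
  rw [h]
  simp only [Function.comp_apply]
  congr 1
  rw [slope_def_field, partZeta_zero, Complex.Gamma_add_one _ hs0]
  field_simp
  ring

/-- The logarithm of the generating function of the partitions counted by `pk (1 / 3)`,
at `exp (-t)`
for real `t`. -/
noncomputable def logGen (t : ℝ) : ℝ := ∑' k : ℕ, heatTrace ((k + 1) * t) / (k + 1)

/-- The diverging part of `logGen` at `0`, without its logarithmic term. -/
noncomputable def polarPart (t : ℝ) : ℝ :=
  π ^ 4 / 15 / t ^ 3 + 3 * realZeta 3 / t ^ 2 + π ^ 2 / 6 / t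

lemma hasSum_one_div_succ_pow_three :
    HasSum (fun k : ℕ => 1 / ((k : ℝ) + 1) ^ 3) (realZeta 3) := by
  have hs : Summable fun n : ℕ => 1 / (n : ℝ) ^ 3 := Real.summable_one_div_nat_pow.2 (by norm_num)
  have h : (riemannZeta 3).re = ∑' n : ℕ, 1 / (n : ℝ) ^ 3 := by
    have := zeta_nat_eq_tsum_of_gt_one (k := 3) (by norm_num)
    rw [show ((3 : ℕ) : ℂ) = 3 by norm_num] at this
    rw [this, ← Complex.ofReal_re (∑' n : ℕ, 1 / (n : ℝ) ^ 3), Complex.ofReal_tsum]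
    push_cast
    rfl
  have h1 := hs.hasSum
  rw [← h, ← hasSum_nat_add_iff' 1] at h1
  simpa [realZeta] using h1

lemma hasSum_one_div_succ_sq :
    HasSum (fun k : ℕ => 1 / ((k : ℝ) + 1) ^ 2) (π ^ 2 / 6) := by
  have h1 := hasSum_zeta_two
  rw [← hasSum_nat_add_iff' 1] at h1
  simpa using h1

lemma hasSum_one_div_succ_pow_four :
    HasSum (fun k : ℕ => 1 / ((k : ℝ) + 1) ^ 4) (π ^ 4 / 90) := by
  have h1 := hasSum_zeta_four
  rw [← hasSum_nat_add_iff' 1] at h1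
  simpa using h1

lemma hasSum_logGen {t : ℝ} (ht : 0 < t) :
    HasSum (fun k : ℕ => heatTrace ((k + 1) * t) / (k + 1))
      (polarPart t + 3 / 4 * Real.log (1 - Real.exp (-t))
        + ∑' k : ℕ, t * (regHeatTrace ((k + 1) * t) / ((k + 1) * t))) := by
  have hq := (hasSum_riemann_step (q := fun u => regHeatTrace u / u) ht antitoneOn_inv_one_add_sq
    (integrable_inv_one_add_sq.const_mul 402).integrableOn
    fun u hu => abs_regHeatTrace_div_le hu).summable.hasSum
  have hlog : HasSum (fun k : ℕ => Real.exp (-t) ^ (k + 1) / (k + 1))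
      (-Real.log (1 - Real.exp (-t))) := by
    refine Real.hasSum_pow_div_log_of_abs_lt_one ?_
    rw [abs_of_pos (Real.exp_pos _)]
    exact Real.exp_lt_one_iff.2 (by linarith)
  convert! ((((hasSum_one_div_succ_pow_four.mul_left (6 / t ^ 3)).add
    (hasSum_one_div_succ_pow_three.mul_left (3 / t ^ 2))).add
    (hasSum_one_div_succ_sq.mul_left (1 / t))).sub (hlog.mul_left (3 / 4))).add hq using 2 with k
  · rw [regHeatTrace, ← Real.exp_nat_mul]
    push_cast
    have : ((k : ℝ) + 1) ≠ 0 := by positivity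
    rw [show ((k : ℝ) + 1) * -t = -((k + 1) * t) by ring]
    field_simp
    ring
  · rw [polarPart]
    ring

lemma tendsto_logGen_sub :
    Tendsto (fun t => logGen t - (polarPart t + 3 / 4 * Real.log t + partZetaDeriv)) (𝓝[>] 0)
      (𝓝 0) := by
  have h1 := tendsto_riemann_sum (q := fun u => regHeatTrace u / u) continuousOn_regHeatTrace_div
    antitoneOn_inv_one_add_sq (integrable_inv_one_add_sq.const_mul 402).integrableOn
    fun u hu => abs_regHeatTrace_div_le hu
  rw [integral_regHeatTrace_div] at h1
  have h2 : Tendsto (fun t : ℝ => (1 - Real.exp (-t)) / t) (𝓝[>] 0) (𝓝 1) := by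
    have hd : HasDerivAt (fun t : ℝ => 1 - Real.exp (-t)) 1 0 := by
      have := ((hasDerivAt_neg (0 : ℝ)).exp).const_sub 1
      simpa using this
    have := (hasDerivAt_iff_tendsto_slope.1 hd).mono_left
      (nhdsWithin_mono _ fun x (hx : 0 < x) => hx.ne')
    refine this.congr fun t => ?_
    simp [slope_def_field]
  have h3 := (h2.log one_ne_zero).const_mul (3 / 4 : ℝ)
  rw [Real.log_one, mul_zero] at h3
  have h4 := (h3.add h1).sub_const partZetaDeriv
  rw [zero_add, sub_self] at h4
  refine h4.congr' ?_
  filter_upwards [self_mem_nhdsWithin] with t ht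
  have ht' : (0 : ℝ) < t := ht
  have he : 0 < 1 - Real.exp (-t) := sub_pos.2 (Real.exp_lt_one_iff.2 (by linarith))
  rw [logGen, (hasSum_logGen ht').tsum_eq, Real.log_div he.ne' ht'.ne']
  ring

/-- The total weight of a multiset of parts with multiplicities `r` and sizes `a`. -/
noncomputable def partWeight (a : ℕ → ℕ) (r : ℕ →₀ ℕ) : ℕ := r.sum fun ℓ j => j * a ℓ

lemma partWeight_add_single (a : ℕ → ℕ) (r : ℕ →₀ ℕ) (N j : ℕ) :
    partWeight a (r + Finsupp.single N j) = partWeight a r + j * a N := by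
  rw [partWeight, Finsupp.sum_add_index' (by simp) (by intros; ring), partWeight,
    Finsupp.sum_single_index (by simp)]

/-- Multiplicities of parts with index at most `N` split into the multiplicity of the part `N` and
the multiplicities of the earlier parts. -/
noncomputable def supportRangeSuccEquiv (N : ℕ) :
    {r : ℕ →₀ ℕ // r.support ⊆ Finset.range N} × ℕ ≃
      {r : ℕ →₀ ℕ // r.support ⊆ Finset.range (N + 1)} where
  toFun p := ⟨p.1.1 + Finsupp.single N p.2, by
    refine Finsupp.support_add.trans (Finset.union_subset ?_ ?_)
    · exact p.1.2.trans (Finset.range_mono (by omega))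
    · exact Finsupp.support_single_subset.trans (by simp)⟩
  invFun r := (⟨r.1.erase N, by
    intro i hi
    have h1 := r.2 (Finsupp.mem_support_iff.2 (Finsupp.mem_support_iff.1
      (Finset.mem_of_mem_erase (by rwa [Finsupp.support_erase] at hi))))
    rw [Finsupp.support_erase, Finset.mem_erase] at hi
    rw [Finset.mem_range] at h1 ⊢
    omega⟩, r.1 N)
  left_inv p := by
    have hN : p.1.1 N = 0 := by
      by_contra h
      simpa using p.1.2 (Finsupp.mem_support_iff.2 h)
    refine Prod.ext (Subtype.ext ?_) ?_
    · ext i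
      by_cases h : i = N
      · subst h
        simp [hN]
      · simp [Finsupp.erase_ne h]
    · simp [hN]
  right_inv r := Subtype.ext (Finsupp.erase_add_single N r.1)

lemma hasSum_partWeight_support_range {a : ℕ → ℕ} (ha : ∀ ℓ, 1 ≤ a ℓ) {z : ℂ} (hz : ‖z‖ < 1)
    (N : ℕ) :
    Summable (fun r : {r : ℕ →₀ ℕ // r.support ⊆ Finset.range N} => ‖z ^ partWeight a r.1‖) ∧
    HasSum (fun r : {r : ℕ →₀ ℕ // r.support ⊆ Finset.range N} => z ^ partWeight a r.1)
      (∏ ℓ ∈ Finset.range N, (1 - z ^ a ℓ)⁻¹) := by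
  induction N with
  | zero =>
    have h0 : ∀ r : {r : ℕ →₀ ℕ // r.support ⊆ Finset.range 0}, r.1 = 0 := fun r =>
      Finsupp.support_eq_empty.1 (Finset.subset_empty.1 r.2)
    let : Unique {r : ℕ →₀ ℕ // r.support ⊆ Finset.range 0} :=
      { default := ⟨0, by simp⟩
        uniq := fun r => Subtype.ext (h0 r) }
    refine ⟨(hasSum_unique _).summable, ?_⟩
    convert! hasSum_unique (fun r : {r : ℕ →₀ ℕ // r.support ⊆ Finset.range 0} =>
      z ^ partWeight a r.1)
  | succ N ih =>
    have hzN : ‖z ^ a N‖ < 1 := by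
      rw [norm_pow]
      exact pow_lt_one₀ (norm_nonneg _) hz (by have := ha N; omega)
    have hg := hasSum_geometric_of_norm_lt_one hzN
    have hgn : Summable fun j : ℕ => ‖(z ^ a N) ^ j‖ := by
      simpa only [norm_pow] using summable_geometric_of_lt_one (norm_nonneg _) hzN
    have key : ∀ p : {r : ℕ →₀ ℕ // r.support ⊆ Finset.range N} × ℕ,
        z ^ partWeight a (supportRangeSuccEquiv N p).1 =
          z ^ partWeight a p.1.1 * (z ^ a N) ^ p.2 := by
      intro p
      rw [supportRangeSuccEquiv, Equiv.coe_fn_mk, partWeight_add_single, pow_add, mul_comm p.2,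
        pow_mul]
    rw [← (supportRangeSuccEquiv N).summable_iff, ← (supportRangeSuccEquiv N).hasSum_iff,
      Finset.prod_range_succ]
    have hs := ih.1.mul_norm hgn
    constructor
    · refine hs.congr fun p => ?_
      rw [Function.comp_apply, key]
    · convert! ih.2.mul hg hs.of_norm using 2 with p
      rw [Function.comp_apply, key]

lemma tendsto_prod_inv_one_sub {a : ℕ → ℕ} {z L : ℂ} (ha : ∀ ℓ, 1 ≤ a ℓ) (hz : ‖z‖ < 1)
    (hL : HasSum (fun ℓ => -Complex.log (1 - z ^ a ℓ)) L) :
    Tendsto (fun N => ∏ ℓ ∈ Finset.range N, (1 - z ^ a ℓ)⁻¹) atTop (𝓝 (Complex.exp L)) := by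
  refine ((Complex.continuous_exp.tendsto _).comp hL.tendsto_sum_nat).congr fun N => ?_
  rw [Function.comp_apply, Complex.exp_sum]
  refine Finset.prod_congr rfl fun ℓ _ => ?_
  rw [Complex.exp_neg, Complex.exp_log]
  intro h
  have h1 : ‖z ^ a ℓ‖ < 1 := by
    rw [norm_pow]
    exact pow_lt_one₀ (norm_nonneg _) hz (by have := ha ℓ; omega)
  rw [← sub_eq_zero.1 h] at h1
  simp at h1

lemma hasSum_neg_log_one_sub {a : ℕ → ℕ} {z : ℂ} (ha : ∀ ℓ, 1 ≤ a ℓ) (hz : ‖z‖ < 1)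
    (hs : Summable fun ℓ => ‖z‖ ^ a ℓ) :
    HasSum (fun ℓ => -Complex.log (1 - z ^ a ℓ))
      (∑' k : ℕ, (∑' ℓ, (z ^ a ℓ) ^ (k + 1)) / (k + 1)) := by
  have hz1 : ∀ ℓ, ‖z ^ a ℓ‖ < 1 := fun ℓ => by
    rw [norm_pow]
    exact pow_lt_one₀ (norm_nonneg _) hz (by have := ha ℓ; omega)
  have hsum : Summable fun p : ℕ × ℕ => (z ^ a p.1) ^ (p.2 + 1) / ((p.2 : ℂ) + 1) := by
    refine Summable.of_norm_bounded (g := fun p : ℕ × ℕ => ‖z‖ ^ a p.1 * ‖z‖ ^ p.2) ?_ ?_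
    · exact hs.mul_of_nonneg (summable_geometric_of_lt_one (norm_nonneg _) hz)
        (fun _ => by positivity) (fun _ => by positivity)
    · rintro ⟨ℓ, k⟩
      simp only
      rw [norm_div, show ((k : ℂ) + 1) = ((k + 1 : ℕ) : ℂ) by push_cast; rfl, Complex.norm_natCast,
        pow_succ', norm_mul, norm_pow, norm_pow, norm_pow]
      refine (div_le_self (by positivity) (by push_cast; linarith [k.cast_nonneg (α := ℝ)])).trans
        ?_
      gcongr ?_ * ?_
      rw [← pow_mul]
      refine pow_le_pow_of_le_one (norm_nonneg _) hz.le ?_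
      exact Nat.le_mul_of_pos_left _ (ha ℓ)
  have h1 : ∀ ℓ, HasSum (fun k : ℕ => (z ^ a ℓ) ^ (k + 1) / ((k : ℂ) + 1))
      (-Complex.log (1 - z ^ a ℓ)) := fun ℓ => by
    have := Complex.hasSum_taylorSeries_neg_log (hz1 ℓ)
    rw [← hasSum_nat_add_iff' 1] at this
    simpa using this
  have h2 := hsum.hasSum.prod_fiberwise h1
  convert! h2 using 1
  rw [← (Equiv.prodComm ℕ ℕ).tsum_eq, Summable.tsum_prod]
  · refine tsum_congr fun k => ?_
    rw [← tsum_div_const]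
    rfl
  · exact (Equiv.prodComm ℕ ℕ).summable_iff.2 hsum

lemma hasSum_partWeight {a : ℕ → ℕ} {z : ℂ} (ha : ∀ ℓ, 1 ≤ a ℓ) (hz : ‖z‖ < 1)
    (hs : Summable fun ℓ => ‖z‖ ^ a ℓ) :
    Summable (fun r : ℕ →₀ ℕ => ‖z ^ partWeight a r‖) ∧
    HasSum (fun r : ℕ →₀ ℕ => z ^ partWeight a r)
      (Complex.exp (∑' k : ℕ, (∑' ℓ, (z ^ a ℓ) ^ (k + 1)) / (k + 1))) := by
  have hsum : Summable (fun r : ℕ →₀ ℕ => ‖z ^ partWeight a r‖) := by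
    have hz' : ‖((‖z‖ : ℝ) : ℂ)‖ < 1 := by simpa using hz
    have hlim :=
      (tendsto_prod_inv_one_sub ha hz' (hasSum_neg_log_one_sub ha hz' (by simpa using hs)))
    obtain ⟨C, hC⟩ := hlim.norm.bddAbove_range
    refine summable_of_sum_le (c := C) (fun _ => norm_nonneg _) fun u => ?_
    obtain ⟨N, hN⟩ : ∃ N, ∀ r ∈ u, r.support ⊆ Finset.range N := by
      obtain ⟨N, hN⟩ := (u.biUnion Finsupp.support).exists_nat_subset_range
      exact ⟨N, fun r hr => (Finset.subset_biUnion_of_mem _ hr).trans hN⟩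
    obtain ⟨h1, h2⟩ := hasSum_partWeight_support_range ha hz' N
    have h3 : ∑' r : {r : ℕ →₀ ℕ // r.support ⊆ Finset.range N}, ‖z ^ partWeight a r.1‖ ≤ C := by
      refine le_trans (le_of_eq ?_) (hC ⟨N, rfl⟩)
      simp only
      rw [← h2.tsum_eq]
      simp_rw [← Complex.ofReal_pow]
      rw [← Complex.ofReal_tsum, Complex.norm_real, Real.norm_of_nonneg
        (tsum_nonneg fun _ => by positivity)]
      simp
    refine le_trans ?_ h3
    have h4 : Summable (fun r : {r : ℕ →₀ ℕ // r.support ⊆ Finset.range N} =>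
      ‖z ^ partWeight a r.1‖) := by simpa using h1
    rw [← Finset.sum_subtype_of_mem _ hN]
    exact h4.sum_le_tsum _ fun _ _ => norm_nonneg _
  refine ⟨hsum, ?_⟩
  have hlim := tendsto_prod_inv_one_sub ha hz (hasSum_neg_log_one_sub ha hz hs)
  have hdom : Tendsto (fun N : ℕ => ∑' r : ℕ →₀ ℕ,
      {r : ℕ →₀ ℕ | r.support ⊆ Finset.range N}.indicator (fun r => z ^ partWeight a r) r) atTop
      (𝓝 (∑' r, z ^ partWeight a r)) := by
    refine tendsto_tsum_of_dominated_convergence hsum ?_ ?_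
    · intro r
      obtain ⟨N, hN⟩ := r.support.exists_nat_subset_range
      refine tendsto_const_nhds.congr' ?_
      filter_upwards [eventually_ge_atTop N] with M hM
      rw [Set.indicator_of_mem]
      exact hN.trans (Finset.range_mono hM)
    · exact Eventually.of_forall fun N r => norm_indicator_le_norm_self _ _
  have := tendsto_nhds_unique hlim (hdom.congr fun N => ?_)
  · rw [this]
    exact hsum.of_norm.hasSum
  · rw [← (hasSum_partWeight_support_range ha hz N).2.tsum_eq]
    exact (tsum_subtype _ _).symm

lemma psPart_one_third_eq_iff (ℓ m : ℕ) : psPart (1 / 3) ℓ = m ↔ m ^ 3 ≤ ℓ ∧ ℓ < (m + 1) ^ 3 := by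
  have hy : 0 ≤ (ℓ : ℝ) ^ (1 / 3 : ℝ) := by positivity
  have h3 : ((ℓ : ℝ) ^ (1 / 3 : ℝ)) ^ 3 = ℓ := by
    rw [← Real.rpow_natCast, ← Real.rpow_mul (by positivity)]
    norm_num
  rw [psPart, Nat.floor_eq_iff hy, ← pow_le_pow_iff_left₀ (by positivity) hy three_ne_zero,
    ← pow_lt_pow_iff_left₀ hy (by positivity) three_ne_zero, h3]
  norm_cast

lemma one_le_psPart_one_third (ℓ : ℕ) : 1 ≤ psPart (1 / 3) (ℓ + 1) := by
  have h := ((psPart_one_third_eq_iff (ℓ + 1) _).1 rfl).2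
  by_contra! h0
  rw [Nat.lt_one_iff.1 h0] at h
  omega

lemma card_psPart_fiber (m : ℕ) :
    Nat.card {ℓ : ℕ // psPart (1 / 3) (ℓ + 1) - 1 = m} = partMult m := by
  have h : ∀ ℓ, psPart (1 / 3) (ℓ + 1) - 1 = m ↔
      ℓ ∈ Finset.Ico ((m + 1) ^ 3 - 1) ((m + 2) ^ 3 - 1) := by
    intro ℓ
    have h1 := one_le_psPart_one_third ℓ
    have h2 : psPart (1 / 3) (ℓ + 1) = m + 1 ↔ (m + 1) ^ 3 ≤ ℓ + 1 ∧ ℓ + 1 < (m + 2) ^ 3 :=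
      psPart_one_third_eq_iff (ℓ + 1) (m + 1)
    have h3 : 0 < (m + 1) ^ 3 := by positivity
    have h4 : 0 < (m + 2) ^ 3 := by positivity
    rw [Finset.mem_Ico]
    omega
  simp_rw [h]
  rw [Nat.card_eq_fintype_card, Fintype.card_coe, Nat.card_Ico, partMult]
  have h3 : 0 < (m + 1) ^ 3 := by positivity
  have h4 : (m + 2) ^ 3 = (m + 1) ^ 3 + (3 * (m + 1) ^ 2 + 3 * (m + 1) + 1) := by ring
  omega

lemma hasSum_comp_fiber {β : Type*} (f : β → ℕ) (g : ℕ → ℂ) (h : Summable fun b => g (f b)) :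
    HasSum (fun n => (Nat.card {b // f b = n} : ℂ) * g n) (∑' b, g (f b)) := by
  have h1 := ((Equiv.sigmaFiberEquiv f).hasSum_iff (f := fun b => g (f b))).2 h.hasSum
  have h2 := h1.sigma fun n => (h1.summable.sigma_factor n).hasSum
  convert! h2 using 2 with n
  have : ∀ c : {b // f b = n}, ((fun b => g (f b)) ∘ (Equiv.sigmaFiberEquiv f)) ⟨n, c⟩ = g n :=
    fun c => by simp [c.2]
  rw [tsum_congr this, tsum_const, nsmul_eq_mul]

lemma summable_pow_psPart {x : ℝ} (hx : 0 < x) (hx1 : x < 1) :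
    Summable fun ℓ => x ^ psPart (1 / 3) (ℓ + 1) := by
  set f : ℕ → ℕ := fun ℓ => psPart (1 / 3) (ℓ + 1) - 1 with hf
  have hcard : ∀ m, Nat.card {ℓ // f ℓ = m} = partMult m := card_psPart_fiber
  have hfin : ∀ m, Finite {ℓ // f ℓ = m} := fun m =>
    Nat.finite_of_card_ne_zero (by rw [hcard]; exact (Nat.succ_ne_zero _))
  have hlog : 0 < -Real.log x := by have := Real.log_neg hx hx1; linarith
  have h2 := (hasSum_heatTrace hlog).summable
  have h1 : Summable ((fun ℓ => x ^ psPart (1 / 3) (ℓ + 1)) ∘ (Equiv.sigmaFiberEquiv f)) := by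
    refine (summable_sigma_of_nonneg fun _ => by
      rw [Function.comp_apply]; positivity).2 ⟨fun m => Summable.of_finite, ?_⟩
    refine h2.congr fun m => ?_
    have : ∀ c : {b // f b = m}, ((fun ℓ => x ^ psPart (1 / 3) (ℓ + 1)) ∘
        (Equiv.sigmaFiberEquiv f)) ⟨m, c⟩ = x ^ (m + 1) := fun c => by
      have h3 := c.2
      have h4 := one_le_psPart_one_third c.1
      simp only [Function.comp_apply, Equiv.sigmaFiberEquiv, Equiv.coe_fn_mk]
      congr 1
      simp only [hf] at h3
      omega
    rw [tsum_congr this, tsum_const, nsmul_eq_mul, hcard]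
    congr 1
    rw [← Real.exp_log hx, ← Real.exp_nat_mul, Real.exp_log hx]
    congr 1
    push_cast
    ring
  exact (Equiv.sigmaFiberEquiv f).summable_iff.1 h1

lemma tsum_exp_psPart {s : ℂ} (hs : 0 < s.re) :
    ∑' ℓ, Complex.exp (-s) ^ psPart (1 / 3) (ℓ + 1) = heatTraceC s := by
  set f : ℕ → ℕ := fun ℓ => psPart (1 / 3) (ℓ + 1) - 1 with hf
  have hfa : ∀ ℓ, psPart (1 / 3) (ℓ + 1) = f ℓ + 1 := fun ℓ => by
    have := one_le_psPart_one_third ℓ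
    simp only [hf]
    omega
  have hsum : Summable fun ℓ => Complex.exp (-s) ^ (f ℓ + 1) := by
    refine Summable.of_norm ?_
    simp_rw [norm_pow, ← hfa]
    exact summable_pow_psPart (by simp) (norm_exp_neg_lt_one hs)
  have h := hasSum_comp_fiber f (fun m => Complex.exp (-s) ^ (m + 1)) hsum
  simp_rw [hfa]
  refine h.unique ?_
  convert! hasSum_heatTraceC hs using 2 with m
  rw [hf, card_psPart_fiber, ← Complex.exp_nat_mul]
  congr 2
  ring

/-- The logarithm of the generating function of the partitions counted by `pk (1 / 3)`, at
`exp (-s)`. -/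
noncomputable def logGenC (s : ℂ) : ℂ := ∑' k : ℕ, heatTraceC ((k + 1) * s) / (k + 1)

lemma ofReal_logGen (t : ℝ) : (logGen t : ℂ) = logGenC t := by
  rw [logGen, logGenC, Complex.ofReal_tsum]
  refine tsum_congr fun k => ?_
  push_cast [ofReal_heatTrace]
  rfl

lemma hasSum_pk {s : ℂ} (hs : 0 < s.re) :
    HasSum (fun n : ℕ => (pk (1 / 3) n : ℂ) * Complex.exp (-s) ^ n) (Complex.exp (logGenC s)) := by
  have hz := norm_exp_neg_lt_one hs
  obtain ⟨h1, h2⟩ := hasSum_partWeight (a := fun ℓ => psPart (1 / 3) (ℓ + 1))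
    one_le_psPart_one_third hz (summable_pow_psPart (by simp) hz)
  have h3 := hasSum_comp_fiber (partWeight fun ℓ => psPart (1 / 3) (ℓ + 1))
    (fun n => Complex.exp (-s) ^ n) h1.of_norm
  rw [h2.tsum_eq] at h3
  convert! h3 using 2
  rw [logGenC]
  refine tsum_congr fun k => ?_
  have hk : 0 < (((k : ℂ) + 1) * s).re := by
    rw [show ((k : ℂ) + 1) = ((k + 1 : ℝ) : ℂ) by push_cast; rfl, Complex.re_ofReal_mul]
    positivity
  rw [← tsum_exp_psPart hk]
  congr 1
  refine tsum_congr fun ℓ => ?_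
  rw [← Complex.exp_nat_mul, ← Complex.exp_nat_mul, ← Complex.exp_nat_mul]
  congr 1
  push_cast
  ring

lemma integral_exp_int_mul (j n : ℕ) (σ : ℝ) :
    ∫ θ in (-π)..π, Complex.exp (((n : ℂ) - j) * (σ + θ * Complex.I)) =
      if j = n then 2 * (π : ℂ) else 0 := by
  split_ifs with h
  · subst h
    simp
    ring
  · have hc : ((n : ℂ) - j) * Complex.I ≠ 0 :=
      mul_ne_zero (sub_ne_zero.2 fun h' => h (Nat.cast_injective h').symm) Complex.I_ne_zero
    have h1 : ∀ θ : ℝ, Complex.exp (((n : ℂ) - j) * (σ + θ * Complex.I)) =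
        Complex.exp (((n : ℂ) - j) * σ) * Complex.exp (((n : ℂ) - j) * Complex.I * θ) := by
      intro θ
      rw [← Complex.exp_add]
      ring_nf
    simp_rw [h1]
    rw [intervalIntegral.integral_const_mul, integral_exp_mul_complex hc]
    have h2 : Complex.exp (((n : ℂ) - j) * Complex.I * (π : ℝ)) =
        Complex.exp (((n : ℂ) - j) * Complex.I * (-π : ℝ)) := by
      rw [Complex.exp_eq_exp_iff_exists_int]
      refine ⟨n - j, ?_⟩
      push_cast
      ring
    rw [h2, sub_self, zero_div, mul_zero]

lemma pk_mul_two_pi_eq_integral {σ : ℝ} (hσ : 0 < σ) (n : ℕ) :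
    (pk (1 / 3) n : ℂ) * (2 * π) = ∫ θ in (-π)..π,
      Complex.exp (logGenC (σ + θ * Complex.I) + n * (σ + θ * Complex.I)) := by
  have hre : ∀ θ : ℝ, ((σ : ℂ) + θ * Complex.I).re = σ := fun θ => by simp
  have hterm : ∀ (j : ℕ) (s : ℂ), (pk (1 / 3) j : ℂ) * Complex.exp (-s) ^ j * Complex.exp (n * s) =
      pk (1 / 3) j * Complex.exp (((n : ℂ) - j) * s) := by
    intro j s
    rw [mul_assoc, ← Complex.exp_nat_mul, ← Complex.exp_add]
    ring_nf
  have hsum : ∀ s : ℂ, 0 < s.re →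
      HasSum (fun j : ℕ => (pk (1 / 3) j : ℂ) * Complex.exp (((n : ℂ) - j) * s))
        (Complex.exp (logGenC s + n * s)) := by
    intro s hs
    rw [Complex.exp_add]
    exact ((hasSum_pk hs).mul_right _).congr_fun fun j => (hterm j s).symm
  have hnorm : ∀ (j : ℕ) (s : ℂ), ‖(pk (1 / 3) j : ℂ) * Complex.exp (((n : ℂ) - j) * s)‖ =
      pk (1 / 3) j * Real.exp ((n - j) * s.re) := by
    intro j s
    rw [norm_mul, Complex.norm_natCast, Complex.norm_exp]
    congr 2
    rw [show ((n : ℂ) - j) = ((n - j : ℝ) : ℂ) by push_cast; rfl, Complex.re_ofReal_mul]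
  have hsumσ : Summable fun j : ℕ => (pk (1 / 3) j : ℝ) * Real.exp ((n - j) * σ) := by
    have := (hsum σ (by simpa using hσ)).summable.norm
    refine this.congr fun j => ?_
    rw [hnorm, Complex.ofReal_re]
  have h := intervalIntegral.hasSum_integral_of_dominated_convergence (a := -π) (b := π)
    (μ := MeasureTheory.volume)
    (F := fun (j : ℕ) (θ : ℝ) =>
      (pk (1 / 3) j : ℂ) * Complex.exp (((n : ℂ) - j) * (σ + θ * Complex.I)))
    (f := fun θ : ℝ => Complex.exp (logGenC (σ + θ * Complex.I) + n * (σ + θ * Complex.I)))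
    (fun j _ => (pk (1 / 3) j : ℝ) * Real.exp ((n - j) * σ))
    (fun j => Continuous.aestronglyMeasurable (by fun_prop))
    (fun j => MeasureTheory.ae_of_all _ fun θ _ => by rw [hnorm, hre])
    (MeasureTheory.ae_of_all _ fun θ _ => hsumσ) (by simp)
    (MeasureTheory.ae_of_all _ fun θ _ => hsum _ (by rw [hre]; exact hσ))
  simp_rw [intervalIntegral.integral_const_mul, integral_exp_int_mul] at h
  refine HasSum.unique ?_ h
  convert! hasSum_ite_eq n ((pk (1 / 3) n : ℂ) * (2 * π)) using 2 with j
  split_ifs with hj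
  · rw [hj]
  · rw [mul_zero]

/-- The exponents of the Dirichlet series of `logGenC`. -/
noncomputable def genFreq (p : ℕ × ℕ) : ℝ := (p.1 + 1) * (p.2 + 1)

/-- The coefficients of the Dirichlet series of `logGenC`. -/
noncomputable def genCoeff (p : ℕ × ℕ) : ℝ := partMult p.2 / (p.1 + 1)

lemma genFreq_pos (p : ℕ × ℕ) : 0 < genFreq p := by
  unfold genFreq
  positivity

lemma genCoeff_nonneg (p : ℕ × ℕ) : 0 ≤ genCoeff p := by
  unfold genCoeff
  positivity

lemma hasSum_logGen_dirichlet {t : ℝ} (ht : 0 < t) :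
    HasSum (fun p => genCoeff p * Real.exp (-(genFreq p * t))) (logGen t) := by
  have h1 : ∀ k : ℕ, HasSum (fun m : ℕ => genCoeff (k, m) * Real.exp (-(genFreq (k, m) * t)))
      (heatTrace ((k + 1) * t) / (k + 1)) := by
    intro k
    have := (hasSum_heatTrace (show 0 < ((k : ℝ) + 1) * t by positivity)).div_const ((k : ℝ) + 1)
    convert! this using 2 with m
    rw [genCoeff, genFreq]
    push_cast
    ring_nf
  have h2 : Summable fun p => genCoeff p * Real.exp (-(genFreq p * t)) := by
    refine (summable_prod_of_nonneg fun p => ?_).2 ⟨fun k => (h1 k).summable, ?_⟩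
    · exact mul_nonneg (genCoeff_nonneg p) (Real.exp_pos _).le
    · simp_rw [fun k => (h1 k).tsum_eq]
      exact (hasSum_logGen ht).summable
  have h3 := h2.hasSum.prod_fiberwise h1
  rw [logGen, h3.tsum_eq]
  exact h2.hasSum

lemma norm_genCoeff_mul_exp (p : ℕ × ℕ) (s : ℂ) :
    ‖(genCoeff p : ℂ) * Complex.exp (-(genFreq p * s))‖ =
      genCoeff p * Real.exp (-(genFreq p * s.re)) := by
  rw [norm_mul, Complex.norm_real, Real.norm_of_nonneg (genCoeff_nonneg p), Complex.norm_exp,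
    Complex.neg_re, Complex.re_ofReal_mul]

lemma hasSum_logGenC_dirichlet {s : ℂ} (hs : 0 < s.re) :
    HasSum (fun p => (genCoeff p : ℂ) * Complex.exp (-(genFreq p * s))) (logGenC s) := by
  have h1 : ∀ k : ℕ, HasSum
      (fun m : ℕ => (genCoeff (k, m) : ℂ) * Complex.exp (-(genFreq (k, m) * s)))
      (heatTraceC ((k + 1) * s) / (k + 1)) := by
    intro k
    have hk : 0 < (((k : ℂ) + 1) * s).re := by
      rw [show ((k : ℂ) + 1) = ((k + 1 : ℝ) : ℂ) by push_cast; rfl, Complex.re_ofReal_mul]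
      positivity
    have := (hasSum_heatTraceC hk).div_const ((k : ℂ) + 1)
    convert! this using 2 with m
    rw [genCoeff, genFreq]
    push_cast
    ring_nf
  have h2 : Summable fun p => (genCoeff p : ℂ) * Complex.exp (-(genFreq p * s)) := by
    refine Summable.of_norm ?_
    simp_rw [norm_genCoeff_mul_exp]
    exact (hasSum_logGen_dirichlet hs).summable
  have h3 := h2.hasSum.prod_fiberwise h1
  rw [logGenC, h3.tsum_eq]
  exact h2.hasSum

lemma pow_mul_exp_neg_le {x t : ℝ} (hx : 0 ≤ x) (ht : 0 < t) (n : ℕ) :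
    x ^ n * Real.exp (-(x * (2 * t))) ≤ n.factorial / t ^ n * Real.exp (-(x * t)) := by
  have h := Real.pow_div_factorial_le_exp (x * t) (by positivity) n
  rw [div_le_iff₀ (by positivity), mul_pow] at h
  rw [show -(x * (2 * t)) = -(x * t) + -(x * t) by ring, Real.exp_add, ← mul_assoc]
  gcongr
  rw [le_div_iff₀ (by positivity)]
  calc x ^ n * Real.exp (-(x * t)) * t ^ n = (x ^ n * t ^ n) * Real.exp (-(x * t)) := by ring
    _ ≤ Real.exp (x * t) * n.factorial * Real.exp (-(x * t)) := by gcongr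
    _ = n.factorial * (Real.exp (x * t) * Real.exp (-(x * t))) := by ring
    _ = n.factorial := by rw [← Real.exp_add]; simp

lemma summable_genFreq_pow {t : ℝ} (ht : 0 < t) (n : ℕ) :
    Summable fun p => genCoeff p * (genFreq p ^ n * Real.exp (-(genFreq p * t))) := by
  refine Summable.of_nonneg_of_le (fun p => mul_nonneg (genCoeff_nonneg p) ?_) (fun p => ?_)
    ((hasSum_logGen_dirichlet (half_pos ht)).summable.mul_left (n.factorial / (t / 2) ^ n))
  · have := (genFreq_pos p).le
    positivity
  · have := pow_mul_exp_neg_le (genFreq_pos p).le (half_pos ht) n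
    rw [mul_div_cancel₀ t two_ne_zero] at this
    calc _ ≤ genCoeff p * (n.factorial / (t / 2) ^ n * Real.exp (-(genFreq p * (t / 2)))) :=
          mul_le_mul_of_nonneg_left this (genCoeff_nonneg p)
      _ = _ := by ring

lemma logGenC_taylor {σ : ℝ} (hσ : 0 < σ) : ∃ c₁ c₂ : ℝ, ∀ μ : ℂ, ‖μ‖ ≤ σ / 2 →
    ‖logGenC (σ + μ) - logGen σ - (c₁ * μ + c₂ * μ ^ 2)‖ ≤
      384 / σ ^ 3 * logGen (σ / 4) * ‖μ‖ ^ 3 := by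
  have hs1 := (summable_genFreq_pow hσ 1).hasSum
  have hs2 := (summable_genFreq_pow hσ 2).hasSum
  refine ⟨-∑' p, genCoeff p * (genFreq p ^ 1 * Real.exp (-(genFreq p * σ))),
    (∑' p, genCoeff p * (genFreq p ^ 2 * Real.exp (-(genFreq p * σ)))) / 2, fun μ hμ => ?_⟩
  have hre : 0 < ((σ : ℂ) + μ).re := by
    rw [Complex.add_re, Complex.ofReal_re]
    have := (abs_le.1 (Complex.abs_re_le_norm μ)).1
    linarith
  have h := ((hasSum_logGenC_dirichlet hre).sub
    (Complex.hasSum_ofReal.2 (hasSum_logGen_dirichlet hσ))).sub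
    (((Complex.hasSum_ofReal.2 hs1.neg).mul_right μ).add
      ((Complex.hasSum_ofReal.2 (hs2.div_const 2)).mul_right (μ ^ 2)))
  have hb := (hasSum_logGen_dirichlet (t := σ / 4) (by positivity)).mul_left
    (384 / σ ^ 3 * ‖μ‖ ^ 3)
  rw [show 384 / σ ^ 3 * logGen (σ / 4) * ‖μ‖ ^ 3 = 384 / σ ^ 3 * ‖μ‖ ^ 3 * logGen (σ / 4) by ring]
  refine h.norm_le_of_bounded hb fun p => ?_
  have hlam := genFreq_pos p
  have hc := genCoeff_nonneg p
  have e1 := Complex.norm_exp_sub_sum_le_norm_mul_exp (-(genFreq p * μ)) 3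
  have e2 := pow_mul_exp_neg_le hlam.le (show 0 < σ / 4 by positivity) 3
  calc _ = ‖(genCoeff p : ℂ) * Complex.exp (-(genFreq p * (σ : ℂ))) *
        (Complex.exp (-(genFreq p * μ)) - ∑ m ∈ Finset.range 3,
          (-(genFreq p * μ)) ^ m / (m.factorial : ℂ))‖ := by
        congr 1
        rw [mul_add, neg_add, Complex.exp_add]
        simp [Finset.sum_range_succ, Nat.factorial]
        ring
    _ ≤ genCoeff p * Real.exp (-(genFreq p * σ)) *
        ((genFreq p * ‖μ‖) ^ 3 * Real.exp (genFreq p * (σ / 2))) := by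
        rw [norm_mul, norm_genCoeff_mul_exp, Complex.ofReal_re]
        have hn : ‖-((genFreq p : ℂ) * μ)‖ = genFreq p * ‖μ‖ := by
          rw [norm_neg, norm_mul, Complex.norm_real, Real.norm_of_nonneg hlam.le]
        rw [hn] at e1
        refine mul_le_mul_of_nonneg_left (e1.trans ?_) (by positivity)
        gcongr
    _ = genCoeff p * ‖μ‖ ^ 3 * (genFreq p ^ 3 * Real.exp (-(genFreq p * (2 * (σ / 4))))) := by
        rw [show -(genFreq p * (2 * (σ / 4))) = -(genFreq p * σ) + genFreq p * (σ / 2) by ring,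
          Real.exp_add]
        ring
    _ ≤ genCoeff p * ‖μ‖ ^ 3 *
        ((3 : ℕ).factorial / (σ / 4) ^ 3 * Real.exp (-(genFreq p * (σ / 4)))) := by gcongr
    _ = _ := by
        simp [Nat.factorial]
        ring

lemma tendsto_sq_add_mul_pow (y : ℝ) :
    Tendsto (fun r : ℝ => r ^ 2 + y * r ^ 5) (𝓝[>] 0) (𝓝[>] 0) := by
  refine tendsto_nhdsWithin_iff.2 ⟨?_, ?_⟩
  · have : Tendsto (fun r : ℝ => r ^ 2 + y * r ^ 5) (𝓝 0) (𝓝 (0 ^ 2 + y * 0 ^ 5)) :=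
      Continuous.tendsto (by fun_prop) 0
    norm_num at this
    exact this.mono_left nhdsWithin_le_nhds
  · have : Tendsto (fun r : ℝ => 1 + y * r ^ 3) (𝓝 0) (𝓝 (1 + y * 0 ^ 3)) :=
      Continuous.tendsto (by fun_prop) 0
    norm_num at this
    have h := (this.mono_left (nhdsWithin_le_nhds (s := Set.Ioi 0))).eventually
      (lt_mem_nhds (zero_lt_one (α := ℝ)))
    filter_upwards [h, self_mem_nhdsWithin] with r h1 h2
    have h2' : (0 : ℝ) < r := h2
    rw [Set.mem_Ioi, show r ^ 2 + y * r ^ 5 = r ^ 2 * (1 + y * r ^ 3) by ring]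
    positivity

/-- The value of `n` for which `exp (n * r ^ 2) * exp (polarPart (r ^ 2))` is stationary in `r`, up
to lower-order terms. -/
noncomputable def saddleValue (r : ℝ) : ℝ := π ^ 4 / 5 / r ^ 8 + 6 * realZeta 3 / r ^ 6

lemma tendsto_logGen_shift (y : ℝ) :
    Tendsto (fun r => logGen (r ^ 2 + y * r ^ 5) - logGen (r ^ 2) + saddleValue r * (y * r ^ 5))
      (𝓝[>] 0) (𝓝 (2 * π ^ 4 / 5 * y ^ 2)) := by
  have h1 := tendsto_logGen_sub.comp (tendsto_sq_add_mul_pow y)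
  have h2 := tendsto_logGen_sub.comp (tendsto_sq_add_mul_pow 0)
  have hc : ContinuousAt (fun r : ℝ =>
      π ^ 4 / 15 * y ^ 2 * (6 + 8 * (y * r ^ 3) + 3 * (y * r ^ 3) ^ 2) / (1 + y * r ^ 3) ^ 3
      + 3 * realZeta 3 * r ^ 2 * y ^ 2 * (3 + 2 * (y * r ^ 3)) / (1 + y * r ^ 3) ^ 2
      - π ^ 2 / 6 * y * r / (1 + y * r ^ 3) + 3 / 4 * Real.log (1 + y * r ^ 3)) 0 := by
    refine ContinuousAt.add (ContinuousAt.sub (ContinuousAt.add ?_ ?_) ?_) ?_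
    · exact ContinuousAt.div (by fun_prop) (by fun_prop) (by norm_num)
    · exact ContinuousAt.div (by fun_prop) (by fun_prop) (by norm_num)
    · exact ContinuousAt.div (by fun_prop) (by fun_prop) (by norm_num)
    · exact continuousAt_const.mul (ContinuousAt.log (by fun_prop) (by norm_num))
  have h3 : Tendsto _ (𝓝[>] (0 : ℝ)) _ := hc.tendsto.mono_left nhdsWithin_le_nhds
  have h4 := (h1.sub h2).add h3
  have hy := (tendsto_sq_add_mul_pow y).eventually self_mem_nhdsWithin
  convert! h4.congr' ?_ using 2
  · norm_num
    ring
  filter_upwards [hy, self_mem_nhdsWithin] with r hr1 hr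
  have hr' : (0 : ℝ) < r := hr
  have hr2 : 0 < r ^ 2 * (1 + y * r ^ 3) := by
    have : (0 : ℝ) < r ^ 2 + y * r ^ 5 := hr1
    convert! this using 1
    ring
  have hr3 : 0 < 1 + y * r ^ 3 := pos_of_mul_pos_right hr2 (by positivity)
  simp only [Function.comp_apply, polarPart, saddleValue]
  rw [show r ^ 2 + y * r ^ 5 = r ^ 2 * (1 + y * r ^ 3) by ring,
    Real.log_mul (by positivity) hr3.ne']
  obtain ⟨e, he⟩ : ∃ e, e = 1 + y * r ^ 3 := ⟨_, rfl⟩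
  have hy : y = (e - 1) / r ^ 3 := by
    rw [he]
    field_simp
    ring
  rw [← he] at hr3
  rw [← he, hy, zero_mul, add_zero]
  generalize logGen (r ^ 2 * e) = A
  generalize logGen (r ^ 2) = B
  field_simp
  ring

lemma exists_logGen_le : ∃ C : ℝ, 0 ≤ C ∧ ∀ᶠ t in 𝓝[>] (0 : ℝ), logGen t ≤ C / t ^ 3 := by
  have h : Tendsto (fun t : ℝ => π ^ 4 / 15 + 3 * realZeta 3 * t + π ^ 2 / 6 * t ^ 2
      + 3 / 4 * (Real.log t * t ^ 3) + partZetaDeriv * t ^ 3) (𝓝[>] 0) (𝓝 (π ^ 4 / 15)) := by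
    have hl : Tendsto (fun t : ℝ => Real.log t * t ^ 3) (𝓝[>] 0) (𝓝 0) := by
      have := tendsto_log_mul_rpow_nhdsGT_zero (r := 3) (by norm_num)
      exact_mod_cast this
    have h1 : Tendsto (fun t : ℝ => π ^ 4 / 15 + 3 * realZeta 3 * t + π ^ 2 / 6 * t ^ 2) (𝓝 0)
        (𝓝 (π ^ 4 / 15 + 3 * realZeta 3 * 0 + π ^ 2 / 6 * 0 ^ 2)) :=
      Continuous.tendsto (by fun_prop) 0
    have h2 : Tendsto (fun t : ℝ => partZetaDeriv * t ^ 3) (𝓝 0) (𝓝 (partZetaDeriv * 0 ^ 3)) :=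
      Continuous.tendsto (by fun_prop) 0
    have := ((h1.mono_left nhdsWithin_le_nhds).add (hl.const_mul (3 / 4))).add
      (h2.mono_left nhdsWithin_le_nhds)
    simpa using this
  have h3 : Tendsto (fun t : ℝ => (logGen t -
      (polarPart t + 3 / 4 * Real.log t + partZetaDeriv)) * t ^ 3) (𝓝[>] 0) (𝓝 0) := by
    have h2 : Tendsto (fun t : ℝ => t ^ 3) (𝓝 0) (𝓝 (0 ^ 3)) := Continuous.tendsto (by fun_prop) 0
    have := tendsto_logGen_sub.mul (h2.mono_left (nhdsWithin_le_nhds (s := Set.Ioi 0)))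
    simpa using this
  refine ⟨π ^ 4 / 15 + 1, by positivity, ?_⟩
  have h4 := (h.add h3).eventually (gt_mem_nhds (show π ^ 4 / 15 + 0 < π ^ 4 / 15 + 1 by simp))
  filter_upwards [h4, self_mem_nhdsWithin] with t ht ht0
  have ht0' : (0 : ℝ) < t := ht0
  rw [le_div_iff₀ (by positivity)]
  refine le_trans (le_of_eq ?_) ht.le
  rw [polarPart]
  field_simp
  ring

lemma tendsto_logGenC_shift (y : ℝ) :
    Tendsto (fun r : ℝ => logGenC (((r ^ 2 : ℝ) : ℂ) + ((y * r ^ 5 : ℝ) : ℂ) * Complex.I)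
        - logGen (r ^ 2) + saddleValue r * (((y * r ^ 5 : ℝ) : ℂ) * Complex.I))
      (𝓝[>] 0) (𝓝 ((-(2 * π ^ 4 / 5 * y ^ 2) : ℝ) : ℂ)) := by
  choose! c₁ c₂ hc using fun σ (hσ : 0 < σ) => logGenC_taylor hσ
  obtain ⟨C, hC0, hC⟩ := exists_logGen_le
  have hsq : Tendsto (fun r : ℝ => r ^ 2 / 4) (𝓝[>] 0) (𝓝[>] 0) := by
    refine tendsto_nhdsWithin_iff.2 ⟨?_, ?_⟩
    · have : Tendsto (fun r : ℝ => r ^ 2 / 4) (𝓝 0) (𝓝 (0 ^ 2 / 4)) :=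
        Continuous.tendsto (by fun_prop) 0
      norm_num at this
      exact this.mono_left nhdsWithin_le_nhds
    · filter_upwards [self_mem_nhdsWithin] with r hr
      have : (0 : ℝ) < r := hr
      rw [Set.mem_Ioi]
      positivity
  have herr : ∀ w : ℂ, Tendsto (fun r : ℝ => logGenC (((r ^ 2 : ℝ) : ℂ) + w * (r : ℂ) ^ 5)
      - logGen (r ^ 2) - (c₁ (r ^ 2) * (w * (r : ℂ) ^ 5)
        + c₂ (r ^ 2) * (w * (r : ℂ) ^ 5) ^ 2)) (𝓝[>] 0) (𝓝 0) := by
    intro w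
    have h0 : Tendsto (fun r : ℝ => 384 * 64 * C * ‖w‖ ^ 3 * r ^ 3) (𝓝[>] 0) (𝓝 0) := by
      have : Tendsto (fun r : ℝ => 384 * 64 * C * ‖w‖ ^ 3 * r ^ 3) (𝓝 0)
        (𝓝 (384 * 64 * C * ‖w‖ ^ 3 * 0 ^ 3)) := Continuous.tendsto (by fun_prop) 0
      rw [zero_pow three_ne_zero, mul_zero] at this
      exact this.mono_left nhdsWithin_le_nhds
    have h1 : ∀ᶠ r : ℝ in 𝓝[>] 0, ‖w‖ * r ^ 3 < 1 / 2 := by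
      have : Tendsto (fun r : ℝ => ‖w‖ * r ^ 3) (𝓝 0) (𝓝 (‖w‖ * 0 ^ 3)) :=
        Continuous.tendsto (by fun_prop) 0
      norm_num at this
      exact (this.mono_left nhdsWithin_le_nhds).eventually (gt_mem_nhds (by norm_num))
    refine squeeze_zero_norm' ?_ h0
    filter_upwards [h1, hsq.eventually hC, self_mem_nhdsWithin] with r hr1 hr2 hr
    have hr' : (0 : ℝ) < r := hr
    have hn : ‖w * (r : ℂ) ^ 5‖ = ‖w‖ * r ^ 5 := by
      rw [norm_mul, norm_pow, Complex.norm_real, Real.norm_of_nonneg hr'.le]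
    refine (hc (r ^ 2) (by positivity) (w * (r : ℂ) ^ 5) ?_).trans ?_
    · rw [hn]
      calc ‖w‖ * r ^ 5 = ‖w‖ * r ^ 3 * r ^ 2 := by ring
        _ ≤ 1 / 2 * r ^ 2 := by gcongr
        _ = r ^ 2 / 2 := by ring
    · rw [hn]
      calc _ ≤ 384 / (r ^ 2) ^ 3 * (C / (r ^ 2 / 4) ^ 3) * (‖w‖ * r ^ 5) ^ 3 := by gcongr
        _ = _ := by
          field_simp
          ring
  have hreal : ∀ x : ℝ, Tendsto (fun r : ℝ => (c₁ (r ^ 2) + saddleValue r) * r ^ 5 * x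
      + c₂ (r ^ 2) * (r ^ 5) ^ 2 * x ^ 2) (𝓝[>] 0) (𝓝 (2 * π ^ 4 / 5 * x ^ 2)) := by
    intro x
    have h1 := (Complex.continuous_re.tendsto _).comp (herr x)
    have h2 := (tendsto_logGen_shift x).sub h1
    rw [Complex.zero_re, sub_zero] at h2
    refine h2.congr fun r => ?_
    simp only [Function.comp_apply]
    rw [show ((r ^ 2 : ℝ) : ℂ) + (x : ℂ) * (r : ℂ) ^ 5 = ((r ^ 2 + x * r ^ 5 : ℝ) : ℂ) by
      push_cast; ring, ← ofReal_logGen]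
    norm_cast
    ring
  have hA : Tendsto (fun r : ℝ => (c₁ (r ^ 2) + saddleValue r) * r ^ 5) (𝓝[>] 0) (𝓝 0) := by
    have := ((hreal 1).sub (hreal (-1))).div_const 2
    convert! this using 2
    · ring
    · ring
  have hB : Tendsto (fun r : ℝ => c₂ (r ^ 2) * (r ^ 5) ^ 2) (𝓝[>] 0) (𝓝 (2 * π ^ 4 / 5)) := by
    have := (hreal 1).sub hA
    convert! this using 2
    · ring
    · ring
  have hA' := ((Complex.continuous_ofReal.tendsto _).comp hA).mul_const (y * Complex.I)
  have hB' := ((Complex.continuous_ofReal.tendsto _).comp hB).mul_const ((y * Complex.I) ^ 2)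
  have := ((herr (y * Complex.I)).add hA').add hB'
  convert! this using 2 with r
  · simp only [Function.comp_apply]
    push_cast
    rw [show (r : ℂ) ^ 2 + y * r ^ 5 * Complex.I = r ^ 2 + y * Complex.I * r ^ 5 by ring]
    ring
  · rw [mul_pow, Complex.I_sq]
    push_cast
    ring

lemma re_logGenC_le_add {s : ℂ} (hs : 0 < s.re) :
    heatTrace s.re - (heatTraceC s).re ≤ logGen s.re - (logGenC s).re := by
  have h1 := (hasSum_logGen_dirichlet hs).sub
    ((Complex.hasSum_iff _ _).1 (hasSum_logGenC_dirichlet hs)).1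
  have h2 := (hasSum_heatTrace hs).sub ((Complex.hasSum_iff _ _).1 (hasSum_heatTraceC hs)).1
  refine hasSum_le_inj (fun m : ℕ => ((0 : ℕ), m)) (Prod.mk_right_injective 0) (fun p _ => ?_)
    (fun m => le_of_eq ?_) h2 h1
  · have := Complex.re_le_norm ((genCoeff p : ℂ) * Complex.exp (-(genFreq p * s)))
    rw [norm_genCoeff_mul_exp] at this
    linarith
  · simp [genCoeff, genFreq]

lemma one_div_sub_one_div_pow_three_ge {d D E σ : ℝ} (hd : 0 < d) (hD : 0 < D) (hE : 0 ≤ E)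
    (hdσ : d ≤ σ) (hDE : d ^ 2 + E ≤ D ^ 2) :
    E / (σ ^ 3 * (σ ^ 2 + E)) ≤ 1 / d ^ 3 - 1 / D ^ 3 := by
  have hdD : d ≤ D := abs_le_of_sq_le_sq' (by nlinarith) hD.le |>.2
  have hσ : 0 < σ := hd.trans_le hdσ
  have h1 : E / (σ ^ 3 * (σ ^ 2 + E)) ≤ E / (d ^ 3 * (d ^ 2 + E)) := by gcongr
  have h2 : E / (d ^ 3 * (d ^ 2 + E)) = 1 / d * (1 / d ^ 2 - 1 / (d ^ 2 + E)) := by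
    field_simp
    ring
  have h3 : 1 / d * (1 / d ^ 2 - 1 / (d ^ 2 + E)) ≤ 1 / d * (1 / d ^ 2 - 1 / D ^ 2) := by gcongr
  have h4 : 1 / D * (1 / D ^ 2) ≤ 1 / d * (1 / D ^ 2) := by gcongr
  rw [h2] at h1
  refine h1.trans (h3.trans ?_)
  calc 1 / d * (1 / d ^ 2 - 1 / D ^ 2) = 1 / d ^ 3 - 1 / d * (1 / D ^ 2) := by
        field_simp
    _ ≤ 1 / d ^ 3 - 1 / D * (1 / D ^ 2) := by linarith
    _ = _ := by field_simp

lemma heatTrace_sub_re_heatTraceC_ge {σ θ : ℝ} (hσ : 0 < σ) (hσ1 : σ ≤ 1 / 2) (hθ : |θ| ≤ π) :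
    3 * (2 / π ^ 2 * θ ^ 2 / (σ ^ 3 * (σ ^ 2 + 2 / π ^ 2 * θ ^ 2))) ≤
      heatTrace σ - (heatTraceC (σ + θ * Complex.I)).re := by
  set s : ℂ := σ + θ * Complex.I with hs
  have hsre : s.re = σ := by simp [hs]
  have hspos : 0 < s.re := by rw [hsre]; exact hσ
  set x := Real.exp (-σ) with hx
  have hx2 : 1 / 2 ≤ x := by
    have := Real.add_one_le_exp (-σ)
    rw [hx]
    linarith
  have hx1 : x < 1 := Real.exp_lt_one_iff.2 (by linarith)
  have hz : ‖Complex.exp (-s)‖ = x := by rw [Complex.norm_exp, Complex.neg_re, hsre]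
  have hd : 0 < 1 - x := by linarith
  have hdD : 1 - x ≤ ‖1 - Complex.exp (-s)‖ := by
    have := norm_sub_norm_le (1 : ℂ) (Complex.exp (-s))
    rwa [norm_one, hz] at this
  have hD : 0 < ‖1 - Complex.exp (-s)‖ := hd.trans_le hdD
  have hDsq : (1 - x) ^ 2 + 2 / π ^ 2 * θ ^ 2 ≤ ‖1 - Complex.exp (-s)‖ ^ 2 := by
    have hre : (Complex.exp (-s)).re = x * Real.cos θ := by
      rw [Complex.exp_re]
      simp [hs, hx]
    have him : (Complex.exp (-s)).im = -(x * Real.sin θ) := by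
      rw [Complex.exp_im]
      simp [hs, hx]
    rw [← Complex.normSq_eq_norm_sq, Complex.normSq_apply, Complex.sub_re, Complex.sub_im, hre, him,
      Complex.one_re, Complex.one_im]
    have hcos := Real.cos_le_one_sub_mul_cos_sq hθ
    have hsc := Real.sin_sq_add_cos_sq θ
    have h1 : 2 / π ^ 2 * θ ^ 2 ≤ 2 * x * (1 - Real.cos θ) := by
      have h0 : 0 ≤ 2 / π ^ 2 * θ ^ 2 := by positivity
      nlinarith
    nlinarith [hsc]
  have hheat : heatTrace σ = 6 * (x / (1 - x) ^ 3) + x / (1 - x) := by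
    have h := heatTraceC_eq (s := (σ : ℂ)) (by simpa using hσ)
    rw [← ofReal_heatTrace] at h
    rw [hx]
    exact_mod_cast h
  have hC : (heatTraceC s).re ≤ 6 * (x / ‖1 - Complex.exp (-s)‖ ^ 3) +
      x / ‖1 - Complex.exp (-s)‖ := by
    refine (Complex.re_le_norm _).trans ?_
    rw [heatTraceC_eq hspos]
    refine (norm_add_le _ _).trans (le_of_eq ?_)
    rw [norm_mul, norm_div, norm_div, norm_pow, hz]
    norm_num
  have hdσ : 1 - x ≤ σ := by
    have := Real.add_one_le_exp (-σ)
    rw [hx]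
    linarith
  have hmain := one_div_sub_one_div_pow_three_ge hd hD (by positivity) hdσ hDsq
  have h5 : x / ‖1 - Complex.exp (-s)‖ ≤ x / (1 - x) := by gcongr
  have h6 : 0 ≤ 2 / π ^ 2 * θ ^ 2 / (σ ^ 3 * (σ ^ 2 + 2 / π ^ 2 * θ ^ 2)) := by positivity
  rw [hheat]
  have h7 : 6 * (x / (1 - x) ^ 3) - 6 * (x / ‖1 - Complex.exp (-s)‖ ^ 3) =
      6 * x * (1 / (1 - x) ^ 3 - 1 / ‖1 - Complex.exp (-s)‖ ^ 3) := by ring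
  have h8 : 3 * (1 / (1 - x) ^ 3 - 1 / ‖1 - Complex.exp (-s)‖ ^ 3) ≤
      6 * x * (1 / (1 - x) ^ 3 - 1 / ‖1 - Complex.exp (-s)‖ ^ 3) :=
    mul_le_mul_of_nonneg_right (by linarith) (h6.trans hmain)
  linarith

lemma re_logGenC_le {r y : ℝ} (hr : 0 < r) (hr1 : r ≤ 1 / 2) (hy : |y * r ^ 5| ≤ π) :
    (logGenC (((r ^ 2 : ℝ) : ℂ) + ((y * r ^ 5 : ℝ) : ℂ) * Complex.I)).re ≤
      logGen (r ^ 2) - 6 / π ^ 2 * (|y| - 1) := by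
  set s : ℂ := ((r ^ 2 : ℝ) : ℂ) + ((y * r ^ 5 : ℝ) : ℂ) * Complex.I with hs
  have hsre : s.re = r ^ 2 := by
    rw [hs, Complex.add_re, Complex.re_ofReal_mul, Complex.ofReal_re, Complex.I_re, mul_zero,
      add_zero]
  have h1 := re_logGenC_le_add (s := s) (by rw [hsre]; positivity)
  have h2 := heatTrace_sub_re_heatTraceC_ge (σ := r ^ 2) (θ := y * r ^ 5) (by positivity)
    (by nlinarith) hy
  rw [hsre] at h1
  have h3 : 6 / π ^ 2 * (|y| - 1) ≤ 3 * (2 / π ^ 2 * (y * r ^ 5) ^ 2 /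
      ((r ^ 2) ^ 3 * ((r ^ 2) ^ 2 + 2 / π ^ 2 * (y * r ^ 5) ^ 2))) := by
    have h4 : 2 / π ^ 2 * (y * r ^ 5) ^ 2 /
        ((r ^ 2) ^ 3 * ((r ^ 2) ^ 2 + 2 / π ^ 2 * (y * r ^ 5) ^ 2)) =
        2 / π ^ 2 * (y ^ 2 / (1 + 2 / π ^ 2 * y ^ 2 * r ^ 6)) := by
      field_simp
    have h5 : 2 / π ^ 2 * y ^ 2 * r ^ 6 ≤ |y| := by
      rw [abs_mul, abs_of_pos (show 0 < r ^ 5 by positivity)] at hy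
      rw [← sq_abs y]
      calc 2 / π ^ 2 * |y| ^ 2 * r ^ 6 = 2 / π ^ 2 * |y| * (|y| * r ^ 5) * r := by ring
        _ ≤ 2 / π ^ 2 * |y| * π * (1 / 2) := by gcongr
        _ = |y| / π := by field_simp
        _ ≤ |y| := div_le_self (abs_nonneg _) (by linarith [Real.pi_gt_three])
    have h6 : |y| - 1 ≤ y ^ 2 / (1 + 2 / π ^ 2 * y ^ 2 * r ^ 6) := by
      calc |y| - 1 ≤ y ^ 2 / (1 + |y|) := by
            rw [le_div_iff₀ (by positivity), ← sq_abs y]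
            nlinarith
        _ ≤ _ := by gcongr
    rw [h4]
    calc 6 / π ^ 2 * (|y| - 1) = 3 * (2 / π ^ 2 * (|y| - 1)) := by ring
      _ ≤ _ := by gcongr
  linarith

/-- The normalized generating function on the vertical line through `r ^ 2`. -/
noncomputable def saddleIntegrand (r : ℝ) (n : ℕ) (y : ℝ) : ℂ :=
  Complex.exp (logGenC (((r ^ 2 : ℝ) : ℂ) + ((y * r ^ 5 : ℝ) : ℂ) * Complex.I)
    - logGen (r ^ 2) + n * (((y * r ^ 5 : ℝ) : ℂ) * Complex.I))

lemma pk_eq_integral_saddleIntegrand {r : ℝ} (hr : 0 < r) (n : ℕ) :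
    (pk (1 / 3) n : ℂ) = ((r ^ 5 / (2 * π) * Real.exp (logGen (r ^ 2) + n * r ^ 2) : ℝ) : ℂ) *
      ∫ y, (Set.Ioc (-π / r ^ 5) (π / r ^ 5)).indicator (saddleIntegrand r n) y := by
  have h := pk_mul_two_pi_eq_integral (σ := r ^ 2) (by positivity) n
  have hr5 : r ^ 5 ≠ 0 := by positivity
  have hle : -π / r ^ 5 ≤ π / r ^ 5 := by
    gcongr
    linarith [Real.pi_pos]
  rw [MeasureTheory.integral_indicator measurableSet_Ioc, ← intervalIntegral.integral_of_le hle]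
  have hsub := intervalIntegral.integral_comp_mul_right (a := -π / r ^ 5) (b := π / r ^ 5)
    (fun θ : ℝ => Complex.exp (logGenC (((r ^ 2 : ℝ) : ℂ) + θ * Complex.I)
      + n * (((r ^ 2 : ℝ) : ℂ) + θ * Complex.I))) hr5
  rw [div_mul_cancel₀ _ hr5, div_mul_cancel₀ _ hr5, ← h] at hsub
  have hI : ∀ y : ℝ, saddleIntegrand r n y =
      Complex.exp (-(logGen (r ^ 2) + n * (r ^ 2 : ℝ) : ℝ)) *
      Complex.exp (logGenC (((r ^ 2 : ℝ) : ℂ) + ((y * r ^ 5 : ℝ) : ℂ) * Complex.I)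
      + n * (((r ^ 2 : ℝ) : ℂ) + ((y * r ^ 5 : ℝ) : ℂ) * Complex.I)) := by
    intro y
    rw [saddleIntegrand, ← Complex.exp_add]
    congr 1
    push_cast
    ring
  simp_rw [hI]
  rw [intervalIntegral.integral_const_mul, hsub, Complex.real_smul]
  have hpi : (π : ℂ) ≠ 0 := by exact_mod_cast Real.pi_ne_zero
  have hrc : (r : ℂ) ≠ 0 := by exact_mod_cast hr.ne'
  push_cast
  have he : Complex.exp (-(logGen (r ^ 2) + n * (r : ℂ) ^ 2)) *
      Complex.exp (logGen (r ^ 2) + n * (r : ℂ) ^ 2) = 1 := by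
    rw [← Complex.exp_add, neg_add_cancel, Complex.exp_zero]
  calc (pk (1 / 3) n : ℂ) =
        r ^ 5 / (2 * π) * (1 * (((r : ℂ) ^ 5)⁻¹ * (pk (1 / 3) n * (2 * π)))) := by
        field_simp
    _ = _ := by
        rw [← he]
        ring

lemma measurable_saddleIntegrand {r : ℝ} (hr : 0 < r) (n : ℕ) :
    Measurable (saddleIntegrand r n) := by
  have hre : ∀ y : ℝ, 0 < (((r ^ 2 : ℝ) : ℂ) + ((y * r ^ 5 : ℝ) : ℂ) * Complex.I).re := fun y => by
    rw [Complex.add_re, Complex.re_ofReal_mul, Complex.ofReal_re, Complex.I_re, mul_zero, add_zero]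
    positivity
  have h1 : Measurable fun y : ℝ =>
      Complex.exp (logGenC (((r ^ 2 : ℝ) : ℂ) + ((y * r ^ 5 : ℝ) : ℂ) * Complex.I)) := by
    refine measurable_of_tendsto_metrizable (f := fun N (y : ℝ) => ∑ j ∈ Finset.range N,
      (pk (1 / 3) j : ℂ) *
        Complex.exp (-(((r ^ 2 : ℝ) : ℂ) + ((y * r ^ 5 : ℝ) : ℂ) * Complex.I)) ^ j)
      (fun N => Continuous.measurable (by fun_prop)) ?_
    exact tendsto_pi_nhds.2 fun y => (hasSum_pk (hre y)).tendsto_sum_nat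
  have h2 : Continuous fun y : ℝ =>
      Complex.exp (-logGen (r ^ 2) + n * (((y * r ^ 5 : ℝ) : ℂ) * Complex.I)) := by fun_prop
  convert! h1.mul h2.measurable using 1
  funext y
  rw [Pi.mul_apply, saddleIntegrand, ← Complex.exp_add]
  congr 1
  ring

lemma integrable_exp_neg_mul_abs {c : ℝ} (hc : 0 < c) :
    MeasureTheory.Integrable fun y : ℝ => Real.exp (-(c * |y|)) := by
  refine (integrable_inv_one_add_sq.const_mul (1 + 2 / c ^ 2)).mono'
    (Continuous.aestronglyMeasurable (by fun_prop)) (MeasureTheory.ae_of_all _ fun y => ?_)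
  have h1 := Real.pow_div_factorial_le_exp (c * |y|) (by positivity) 2
  have h2 := Real.one_le_exp (show 0 ≤ c * |y| by positivity)
  rw [Nat.factorial_two, mul_pow, sq_abs] at h1
  rw [Real.norm_of_nonneg (Real.exp_pos _).le, Real.exp_neg, ← div_eq_mul_inv,
    inv_le_comm₀ (Real.exp_pos _) (by positivity), inv_div, div_le_iff₀ (by positivity)]
  have h3 : y ^ 2 ≤ 2 / c ^ 2 * Real.exp (c * |y|) := by
    calc y ^ 2 = 2 / c ^ 2 * (c ^ 2 * y ^ 2 / (2 : ℕ)) := by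
          push_cast
          field_simp
      _ ≤ _ := by gcongr
  linarith

lemma tendsto_integral_saddleIntegrand {r : ℕ → ℝ} (hr : Tendsto r atTop (𝓝[>] 0))
    (hn : Tendsto (fun n : ℕ => (n - saddleValue (r n)) * r n ^ 5) atTop (𝓝 0)) :
    Tendsto (fun n => ∫ y, (Set.Ioc (-π / r n ^ 5) (π / r n ^ 5)).indicator
      (saddleIntegrand (r n) n) y) atTop (𝓝 ((√(π / (2 * π ^ 4 / 5)) : ℝ) : ℂ)) := by
  have hg : ((√(π / (2 * π ^ 4 / 5)) : ℝ) : ℂ) =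
      ∫ y : ℝ, ((Real.exp (-(2 * π ^ 4 / 5) * y ^ 2) : ℝ) : ℂ) := by
    rw [integral_complex_ofReal, integral_gaussian]
  have hr0 : ∀ᶠ n in atTop, 0 < r n := hr.eventually self_mem_nhdsWithin
  have hr1 : ∀ᶠ n in atTop, r n < 1 / 2 :=
    hr.eventually (nhdsWithin_le_nhds (gt_mem_nhds (by norm_num)))
  rw [hg]
  refine MeasureTheory.tendsto_integral_filter_of_dominated_convergence
    (fun y => Real.exp (6 / π ^ 2) * Real.exp (-(6 / π ^ 2 * |y|))) ?_ ?_ ?_ ?_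
  · filter_upwards [hr0] with n h0
    exact ((measurable_saddleIntegrand h0 n).indicator measurableSet_Ioc).aestronglyMeasurable
  · filter_upwards [hr0, hr1] with n h0 h1
    refine MeasureTheory.ae_of_all _ fun y => ?_
    rw [Set.indicator_apply]
    split_ifs with hy
    · have hy' : |y * r n ^ 5| ≤ π := by
        have h2 := (div_lt_iff₀ (show 0 < r n ^ 5 by positivity)).1 hy.1
        have h3 := (le_div_iff₀ (show 0 < r n ^ 5 by positivity)).1 hy.2
        exact abs_le.2 ⟨h2.le, h3⟩
      have h4 := re_logGenC_le h0 h1.le hy'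
      rw [saddleIntegrand, Complex.norm_exp, ← Real.exp_add]
      gcongr
      rw [Complex.add_re, Complex.sub_re, Complex.ofReal_re, ← Complex.ofReal_natCast,
        Complex.re_ofReal_mul, Complex.re_ofReal_mul, Complex.I_re]
      linarith
    · rw [norm_zero]
      positivity
  · exact (integrable_exp_neg_mul_abs (by positivity)).const_mul _
  · refine MeasureTheory.ae_of_all _ fun y => ?_
    have h1 := (tendsto_logGenC_shift y).comp hr
    have h2 := ((Complex.continuous_ofReal.tendsto _).comp hn).mul_const (y * Complex.I)
    have h3 := (Complex.continuous_exp.tendsto _).comp (h1.add h2)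
    have hmem : ∀ᶠ n in atTop, y ∈ Set.Ioc (-π / r n ^ 5) (π / r n ^ 5) := by
      have h4 : Tendsto (fun n => |y| * r n ^ 5) atTop (𝓝 (|y| * 0 ^ 5)) :=
        ((hr.mono_right nhdsWithin_le_nhds).pow 5).const_mul _
      rw [zero_pow (by norm_num), mul_zero] at h4
      filter_upwards [hr0, h4.eventually (gt_mem_nhds Real.pi_pos)] with n h0 h5
      have h6 : 0 < r n ^ 5 := by positivity
      rw [Set.mem_Ioc, div_lt_iff₀ h6, le_div_iff₀ h6]
      have h8 : |y * r n ^ 5| < π := by rwa [abs_mul, abs_of_pos h6]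
      have := abs_lt.1 h8
      exact ⟨this.1, this.2.le⟩
    have h7 : ((Real.exp (-(2 * π ^ 4 / 5) * y ^ 2) : ℝ) : ℂ) = Complex.exp
        (((-(2 * π ^ 4 / 5 * y ^ 2) : ℝ) : ℂ) + ((0 : ℝ) : ℂ) * (y * Complex.I)) := by
      push_cast
      ring_nf
    rw [h7]
    refine h3.congr' ?_
    filter_upwards [hmem] with n hy
    rw [Set.indicator_of_mem hy, saddleIntegrand]
    simp only [Function.comp_apply]
    congr 1
    push_cast
    ring

/-- The shift of the saddle point caused by the second pole of `polarPart`. -/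
noncomputable def saddleShift : ℝ := 15 * realZeta 3 / (2 * π ^ 3)

/-- The square root of the approximate saddle point for `pk (1 / 3) n`. -/
noncomputable def saddleRadius (n : ℕ) : ℝ :=
  √(π / ((5 * (n : ℝ)) ^ ((1 : ℝ) / 4) - saddleShift))

lemma tendsto_quarter_root_sub :
    Tendsto (fun n : ℕ => (5 * (n : ℝ)) ^ ((1 : ℝ) / 4) - saddleShift) atTop atTop :=
  tendsto_atTop_add_const_right _ _ ((tendsto_rpow_atTop (by norm_num)).comp
    (tendsto_natCast_atTop_atTop.const_mul_atTop (by norm_num)))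

lemma tendsto_saddleRadius : Tendsto saddleRadius atTop (𝓝[>] 0) := by
  refine tendsto_nhdsWithin_iff.2 ⟨?_, ?_⟩
  · have h := (Real.continuous_sqrt.tendsto 0).comp (tendsto_quarter_root_sub.const_div_atTop π)
    rwa [Real.sqrt_zero] at h
  · filter_upwards [tendsto_quarter_root_sub.eventually_gt_atTop 0] with n hn
    exact Real.sqrt_pos.2 (div_pos Real.pi_pos hn)

lemma eventually_saddleRadius_eq : ∀ᶠ n : ℕ in atTop, 0 < saddleRadius n ∧
    (5 * (n : ℝ)) ^ ((1 : ℝ) / 4) = π / saddleRadius n ^ 2 + saddleShift := by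
  filter_upwards [tendsto_quarter_root_sub.eventually_gt_atTop 0] with n hn
  refine ⟨Real.sqrt_pos.2 (div_pos Real.pi_pos hn), ?_⟩
  rw [saddleRadius, Real.sq_sqrt (div_pos Real.pi_pos hn).le, div_div_cancel₀ Real.pi_ne_zero]
  ring

lemma natCast_eq_quarter_root_pow (n : ℕ) : (n : ℝ) = ((5 * (n : ℝ)) ^ ((1 : ℝ) / 4)) ^ 4 / 5 := by
  rw [← Real.rpow_natCast, ← Real.rpow_mul (by positivity)]
  norm_num

lemma tendsto_sub_saddleValue :
    Tendsto (fun n : ℕ => (n - saddleValue (saddleRadius n)) * saddleRadius n ^ 5) atTop (𝓝 0) := by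
  have h : Tendsto (fun r : ℝ => (6 * π ^ 2 * saddleShift ^ 2 * r + 4 * π * saddleShift ^ 3 * r ^ 3
      + saddleShift ^ 4 * r ^ 5) / 5) (𝓝 0) (𝓝 ((6 * π ^ 2 * saddleShift ^ 2 * 0
      + 4 * π * saddleShift ^ 3 * 0 ^ 3 + saddleShift ^ 4 * 0 ^ 5) / 5)) :=
    Continuous.tendsto (by fun_prop) 0
  norm_num at h
  refine (h.comp (tendsto_saddleRadius.mono_right nhdsWithin_le_nhds)).congr' ?_
  filter_upwards [eventually_saddleRadius_eq] with n hn
  have hr := hn.1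
  rw [Function.comp_apply, natCast_eq_quarter_root_pow n, hn.2, saddleValue]
  have hz : realZeta 3 = 2 * π ^ 3 / 15 * saddleShift := by
    rw [saddleShift]
    field_simp
  rw [hz]
  field_simp
  ring

/-- The exponent at the approximate saddle point, with `x` in place of `(5 * n) ^ (1 / 4)`. -/
lemma polarPart_add_eq {r x : ℝ} (hr : 0 < r) (hx : x = π / r ^ 2 + saddleShift) :
    polarPart (r ^ 2) + x ^ 4 / 5 * r ^ 2 = 4 * π / 15 * x ^ 3 + 3 * realZeta 3 / π ^ 2 * x ^ 2
      + (π ^ 6 - 135 * realZeta 3 ^ 2) / (6 * π ^ 5) * x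
      + (225 * realZeta 3 ^ 3 / π ^ 8 - 5 * realZeta 3 / (4 * π ^ 2))
      + saddleShift ^ 4 * r ^ 2 / 5 := by
  rw [polarPart, hx, saddleShift]
  field_simp
  ring

lemma log_const_eq :
    13 / 4 * Real.log π - Real.log (2 * π) + partZetaDeriv
      + (225 * realZeta 3 ^ 3 / π ^ 8 - 5 * realZeta 3 / (4 * π ^ 2))
      - (1 / 4 * Real.log (25 * π) + (225 * realZeta 3 ^ 3 / π ^ 8 - 2 * realZeta 3 / π ^ 2
        + 3 * realZetaDeriv (-1)) - Real.log 4) = -Real.log √(π / (2 * π ^ 4 / 5)) := by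
  have hpi := Real.pi_pos
  rw [Real.log_sqrt (by positivity), Real.log_div (by positivity) (by positivity),
    Real.log_div (by positivity) (by positivity), Real.log_mul (by positivity) (by positivity),
    Real.log_mul (by positivity) (by positivity), Real.log_mul (by positivity) (by positivity),
    Real.log_pow, show (25 : ℝ) = 5 ^ 2 by norm_num, Real.log_pow,
    show (4 : ℝ) = 2 ^ 2 by norm_num, Real.log_pow, partZetaDeriv,
    Real.log_mul (by positivity) (by positivity)]
  push_cast
  field_simp
  ring

/-- The claimed asymptotic equivalent of `pk (1 / 3) n`. -/
noncomputable def pkMain (n : ℕ) : ℝ :=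
  ((25 * π) ^ ((1 : ℝ) / 4) *
      Real.exp (225 * (realZeta 3) ^ 3 / π ^ 8 - 2 * realZeta 3 / π ^ 2 +
        3 * realZetaDeriv (-1)) / (4 * (5 * (n : ℝ)) ^ ((13 : ℝ) / 16))) *
    Real.exp ((4 * π / 15) * (5 * (n : ℝ)) ^ ((3 : ℝ) / 4) +
      (3 * realZeta 3 / π ^ 2) * (5 * (n : ℝ)) ^ ((1 : ℝ) / 2) +
      ((π ^ 6 - 135 * (realZeta 3) ^ 2) / (6 * π ^ 5)) * (5 * (n : ℝ)) ^ ((1 : ℝ) / 4))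

lemma pkMain_eq {n : ℕ} (hn : 0 < n) {x : ℝ} (hx : x = (5 * (n : ℝ)) ^ ((1 : ℝ) / 4)) :
    pkMain n = Real.exp (1 / 4 * Real.log (25 * π) +
      (225 * realZeta 3 ^ 3 / π ^ 8 - 2 * realZeta 3 / π ^ 2 + 3 * realZetaDeriv (-1))
      - Real.log 4 - 13 / 4 * Real.log x + (4 * π / 15 * x ^ 3 + 3 * realZeta 3 / π ^ 2 * x ^ 2
      + (π ^ 6 - 135 * realZeta 3 ^ 2) / (6 * π ^ 5) * x)) := by
  have h5 : (0 : ℝ) < 5 * n := by positivity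
  have hx0 : 0 < x := hx ▸ Real.rpow_pos_of_pos h5 _
  have h3 : (5 * (n : ℝ)) ^ ((3 : ℝ) / 4) = x ^ 3 := by
    rw [hx, ← Real.rpow_natCast, ← Real.rpow_mul h5.le]
    norm_num
  have h2 : (5 * (n : ℝ)) ^ ((1 : ℝ) / 2) = x ^ 2 := by
    rw [hx, ← Real.rpow_natCast, ← Real.rpow_mul h5.le]
    norm_num
  have h13 : (5 * (n : ℝ)) ^ ((13 : ℝ) / 16) = Real.exp (13 / 4 * Real.log x) := by
    rw [hx, Real.log_rpow h5, Real.rpow_def_of_pos h5]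
    ring_nf
  rw [pkMain, h3, h2, h13, ← hx, Real.rpow_def_of_pos (by positivity)]
  generalize 225 * realZeta 3 ^ 3 / π ^ 8 - 2 * realZeta 3 / π ^ 2 + 3 * realZetaDeriv (-1) = a
  generalize 4 * π / 15 * x ^ 3 + 3 * realZeta 3 / π ^ 2 * x ^ 2
    + (π ^ 6 - 135 * realZeta 3 ^ 2) / (6 * π ^ 5) * x = b
  rw [Real.exp_add (_ - _) b, Real.exp_sub, Real.exp_sub, Real.exp_add,
    Real.exp_log (by norm_num : (0 : ℝ) < 4), mul_comm (Real.log _) (1 / 4), div_div]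

lemma tendsto_prefactor_div :
    Tendsto (fun n : ℕ => saddleRadius n ^ 5 / (2 * π) *
      Real.exp (logGen (saddleRadius n ^ 2) + n * saddleRadius n ^ 2) / pkMain n) atTop
      (𝓝 (√(π / (2 * π ^ 4 / 5)))⁻¹) := by
  have hsq : Tendsto (fun n => saddleRadius n ^ 2) atTop (𝓝 0) := by
    simpa using (tendsto_saddleRadius.mono_right nhdsWithin_le_nhds).pow 2
  have h1 : Tendsto (fun n => logGen (saddleRadius n ^ 2) - (polarPart (saddleRadius n ^ 2)
      + 3 / 4 * Real.log (saddleRadius n ^ 2) + partZetaDeriv)) atTop (𝓝 0) := by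
    refine tendsto_logGen_sub.comp (tendsto_nhdsWithin_iff.2 ⟨hsq, ?_⟩)
    filter_upwards [eventually_saddleRadius_eq] with n hn
    exact pow_pos hn.1 2
  have h2 : Tendsto (fun n => Real.log (1 + saddleShift / π * saddleRadius n ^ 2)) atTop (𝓝 0) := by
    have := (hsq.const_mul (saddleShift / π)).const_add 1
    rw [mul_zero, add_zero] at this
    simpa using this.log one_ne_zero
  have h3 : Tendsto (fun n => saddleShift ^ 4 * saddleRadius n ^ 2 / 5) atTop (𝓝 0) := by
    simpa using (hsq.const_mul (saddleShift ^ 4)).div_const 5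
  have h4 := ((h1.add h3).add (h2.const_mul (13 / 4))).add_const
    (-Real.log √(π / (2 * π ^ 4 / 5)))
  rw [mul_zero, zero_add, zero_add, zero_add] at h4
  have hpos : 0 < √(π / (2 * π ^ 4 / 5)) := by positivity
  have h5 := (Real.continuous_exp.tendsto _).comp h4
  rw [Real.exp_neg, Real.exp_log hpos] at h5
  refine h5.congr' ?_
  filter_upwards [eventually_saddleRadius_eq, eventually_gt_atTop 0] with n hn hn0
  obtain ⟨hr, hx⟩ := hn
  have hnx := natCast_eq_quarter_root_pow n
  have hxpos : 0 < (5 * (n : ℝ)) ^ ((1 : ℝ) / 4) := by positivity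
  rw [pkMain_eq hn0 rfl, Function.comp_apply]
  generalize hX : (5 * (n : ℝ)) ^ ((1 : ℝ) / 4) = x at *
  generalize saddleRadius n = r at *
  have hmain := polarPart_add_eq hr hx
  have hlogx : Real.log (1 + saddleShift / π * r ^ 2) =
      Real.log x + 2 * Real.log r - Real.log π := by
    rw [show 1 + saddleShift / π * r ^ 2 = x * r ^ 2 / π by rw [hx]; field_simp,
      Real.log_div (by positivity) Real.pi_ne_zero, Real.log_mul hxpos.ne' (by positivity),
      Real.log_pow]
    push_cast
    ring
  have hpre : r ^ 5 / (2 * π) = Real.exp (5 * Real.log r - Real.log (2 * π)) := by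
    rw [Real.exp_sub, Real.exp_log (by positivity),
      show 5 * Real.log r = Real.log (r ^ 5) by rw [Real.log_pow]; norm_num,
      Real.exp_log (by positivity)]
  rw [hpre, ← Real.exp_add, ← Real.exp_sub, hlogx, ← log_const_eq, hnx, Real.log_pow]
  congr 1
  push_cast
  linear_combination -hmain

lemma tendsto_pk_div_pkMain : Tendsto (fun n : ℕ => (pk (1 / 3) n : ℝ) / pkMain n) atTop (𝓝 1) := by
  have h := (Complex.continuous_re.tendsto _).comp
    (tendsto_integral_saddleIntegrand tendsto_saddleRadius tendsto_sub_saddleValue)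
  have h2 := tendsto_prefactor_div.mul h
  have hpos : 0 < √(π / (2 * π ^ 4 / 5)) := by positivity
  rw [Complex.ofReal_re, inv_mul_cancel₀ hpos.ne'] at h2
  refine h2.congr' ?_
  filter_upwards [eventually_saddleRadius_eq] with n hn
  have := congrArg Complex.re (pk_eq_integral_saddleIntegrand hn.1 n)
  rw [Complex.natCast_re, Complex.re_ofReal_mul] at this
  rw [this, Function.comp_apply]
  ring

theorem stmt4 :
    Tendsto (fun n : ℕ => (pk (1 / 3) n : ℝ) /
        (((25 * π) ^ ((1 : ℝ) / 4) *
            Real.exp (225 * (realZeta 3) ^ 3 / π ^ 8 - 2 * realZeta 3 / π ^ 2 +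
              3 * realZetaDeriv (-1)) / (4 * (5 * (n : ℝ)) ^ ((13 : ℝ) / 16))) *
          Real.exp ((4 * π / 15) * (5 * (n : ℝ)) ^ ((3 : ℝ) / 4) +
            (3 * realZeta 3 / π ^ 2) * (5 * (n : ℝ)) ^ ((1 : ℝ) / 2) +
            ((π ^ 6 - 135 * (realZeta 3) ^ 2) / (6 * π ^ 5)) * (5 * (n : ℝ)) ^ ((1 : ℝ) / 4))))
      atTop (𝓝 1) :=
  tendsto_pk_div_pkMain
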